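/- For every integer k ≥ 1 there exists an integer M = M(k) such that for every k-tangle τ in a graph G there exist a connected topological minor G' of G with fewer than M edges and a k-tangle τ' in G' with the following property: whenever a weight function w' on V(G') induces τ', the weight function w on V(G) that extends w' by zero induces τ. In particular, any set of vertices of G' that induces τ' also induces τ (as a subset of V(G)). -/

import Mathlib

open Finset

variable {V : Type} [Fintype V] [DecidableEq V]

/-- `{A, B}` is a separation of the graph `G`: the two sides together cover the vertex set and
no edge of `G` joins `A \ B` to `B \ A`. -/
def IsSep (G : SimpleGraph V) (A B : Finset V) : Prop :=
  A ∪ B = Finset.univ ∧ ∀ a ∈ A \ B, ∀ b ∈ B \ A, ¬ G.Adj a b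

/-- `G[A₁] ∪ G[A₂] ∪ G[A₃] = G` for the induced subgraphs on `A₁`, `A₂`, `A₃`. -/
def CoversG (G : SimpleGraph V) (A₁ A₂ A₃ : Finset V) : Prop :=
  (∀ v : V, v ∈ A₁ ∨ v ∈ A₂ ∨ v ∈ A₃) ∧
    ∀ u v : V, G.Adj u v →
      (u ∈ A₁ ∧ v ∈ A₁) ∨ (u ∈ A₂ ∧ v ∈ A₂) ∨ (u ∈ A₃ ∧ v ∈ A₃)

/-- `τ` is a `k`-tangle in `G`: a set of oriented separations of order `< k` containing exactly
one orientation of every separation of order `< k`, and no three of its elements have small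
sides whose induced subgraphs together cover `G`. -/
def IsTangle (G : SimpleGraph V) (k : ℕ) (τ : Set (Finset V × Finset V)) : Prop :=
  (∀ p ∈ τ, IsSep G p.1 p.2 ∧ (p.1 ∩ p.2).card < k) ∧
    (∀ A B : Finset V, IsSep G A B → (A ∩ B).card < k → ((A, B) ∈ τ ↔ (B, A) ∉ τ)) ∧
    ∀ p₁ ∈ τ, ∀ p₂ ∈ τ, ∀ p₃ ∈ τ, ¬ CoversG G p₁.1 p₂.1 p₃.1

/-- The weight function `w` induces the tangle `τ`. -/
def InducesW (τ : Set (Finset V × Finset V)) (w : V → ℕ) : Prop :=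
  ∀ p ∈ τ, ∑ x ∈ p.1, w x < ∑ x ∈ p.2, w x

/-- The vertex set `X` induces the tangle `τ` by majority vote. -/
def InducesSet (τ : Set (Finset V × Finset V)) (X : Finset V) : Prop :=
  ∀ p ∈ τ, (X ∩ p.1).card < (X ∩ p.2).card

/-- `G'`, a graph on the vertex set `s ⊆ V(G)`, is a topological minor of `G` (with the
identity embedding on branch vertices): there is a subdivision of `G'` inside `G`, i.e. a
system of internally disjoint paths of `G`, one for each edge of `G'`, joining its endvertices
and internally avoiding `s`. -/
def IsTopMinorOn (G : SimpleGraph V) (s : Finset V)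
    (G' : SimpleGraph {x : V // x ∈ s}) : Prop :=
  ∃ P : ∀ u v : {x : V // x ∈ s}, G'.Adj u v → G.Walk u.val v.val,
    (∀ u v h, (P u v h).IsPath) ∧
    (∀ u v h, ∀ x ∈ (P u v h).support, x ≠ u.val → x ≠ v.val → x ∉ s) ∧
    (∀ u v (h : G'.Adj u v) u' v' (h' : G'.Adj u' v'), s(u, v) ≠ s(u', v') →
      ∀ x ∈ (P u v h).support, x ∈ (P u' v' h').support →
        (x = u.val ∨ x = v.val) ∧ (x = u'.val ∨ x = v'.val))

/-- The extension of `w'` by zero from `s` to all of `V`. -/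
def extendByZero (s : Finset V) (w' : {x : V // x ∈ s} → ℕ) : V → ℕ :=
  fun x => if h : x ∈ s then w' ⟨x, h⟩ else 0

section Separations

variable {G H : SimpleGraph V} {A B A' B' : Finset V}

theorem isSep_iff : IsSep G A B ↔ (∀ x, x ∈ A ∨ x ∈ B) ∧
    ∀ u v, G.Adj u v → (u ∈ A ∧ v ∈ A) ∨ (u ∈ B ∧ v ∈ B) := by
  constructor
  · rintro ⟨h1, h2⟩
    have h3 : ∀ x, x ∈ A ∨ x ∈ B := fun x => by
      have := Finset.mem_univ x
      rwa [← h1, Finset.mem_union] at this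
    refine ⟨h3, fun u v huv => ?_⟩
    have a1 := h2 u
    have a2 := h2 v
    have a3 := huv.symm
    have := h3 u
    have := h3 v
    simp only [Finset.mem_sdiff] at a1 a2
    by_contra hc
    rcases h3 u with hu | hu <;> rcases h3 v with hv | hv
    · tauto
    · exact a1 ⟨hu, fun h => hc (Or.inr ⟨h, hv⟩)⟩ v ⟨hv, fun h => hc (Or.inl ⟨hu, h⟩)⟩ huv
    · exact a2 ⟨hv, fun h => hc (Or.inr ⟨hu, h⟩)⟩ u ⟨hu, fun h => hc (Or.inl ⟨h, hv⟩)⟩ a3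
    · tauto
  · rintro ⟨h1, h2⟩
    refine ⟨by ext x; simpa using h1 x, fun a ha b hb hab => ?_⟩
    have := h2 a b hab
    simp only [Finset.mem_sdiff] at ha hb
    tauto

theorem IsSep.cover (h : IsSep G A B) (x : V) : x ∈ A ∨ x ∈ B := (isSep_iff.1 h).1 x

theorem IsSep.edge (h : IsSep G A B) {u v : V} (huv : G.Adj u v) :
    (u ∈ A ∧ v ∈ A) ∨ (u ∈ B ∧ v ∈ B) := (isSep_iff.1 h).2 u v huv

theorem IsSep.symm (h : IsSep G A B) : IsSep G B A :=
  isSep_iff.2 ⟨fun x => (h.cover x).symm, fun _ _ huv => (h.edge huv).symm⟩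

theorem IsSep.anti (hle : H ≤ G) (h : IsSep G A B) : IsSep H A B :=
  isSep_iff.2 ⟨h.cover, fun _ _ huv => h.edge (hle huv)⟩

theorem IsSep.sup (h : IsSep G A B) (h' : IsSep G A' B') : IsSep G (A ∪ A') (B ∩ B') := by
  refine isSep_iff.2 ⟨fun x => ?_, fun u v huv => ?_⟩
  · have := h.cover x
    have := h'.cover x
    simp only [Finset.mem_union, Finset.mem_inter]
    tauto
  · have := h.edge huv
    have := h'.edge huv
    simp only [Finset.mem_union, Finset.mem_inter]
    tauto

theorem IsSep.inf (h : IsSep G A B) (h' : IsSep G A' B') : IsSep G (A ∩ A') (B ∪ B') :=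
  (h.symm.sup h'.symm).symm

theorem IsSep.card_add (h : IsSep G A B) :
    (A ∩ B).card + Fintype.card V = A.card + B.card := by
  rw [← Finset.card_univ, ← h.1, add_comm, Finset.card_union_add_card_inter]

/-- The order of separations is modular. -/
theorem IsSep.card_sup_add_card_inf (h : IsSep G A B) (h' : IsSep G A' B') :
    ((A ∪ A') ∩ (B ∩ B')).card + ((A ∩ A') ∩ (B ∪ B')).card =
      (A ∩ B).card + (A' ∩ B').card := by
  have h1 := (h.sup h').card_add
  have h2 := (h.inf h').card_add
  have h3 := h.card_add
  have h4 := h'.card_add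
  have h5 := Finset.card_union_add_card_inter A A'
  have h6 := Finset.card_union_add_card_inter B B'
  omega

end Separations

section Tangles

variable {G : SimpleGraph V} {k : ℕ} {τ : Set (Finset V × Finset V)}

/-- `q` is a vertex (on the diagonal) or an edge of `G`. -/
def IsItem (G : SimpleGraph V) (q : V × V) : Prop := q.1 = q.2 ∨ G.Adj q.1 q.2

theorem IsSep.item {A B : Finset V} (h : IsSep G A B) {q : V × V} (hq : IsItem G q) :
    (q.1 ∈ A ∧ q.2 ∈ A) ∨ (q.1 ∈ B ∧ q.2 ∈ B) := by
  rcases hq with hq | hq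
  · rw [hq]
    have := h.cover q.2
    tauto
  · exact h.edge hq

theorem coversG_iff {A₁ A₂ A₃ : Finset V} : CoversG G A₁ A₂ A₃ ↔ ∀ q, IsItem G q →
    (q.1 ∈ A₁ ∧ q.2 ∈ A₁) ∨ (q.1 ∈ A₂ ∧ q.2 ∈ A₂) ∨ (q.1 ∈ A₃ ∧ q.2 ∈ A₃) := by
  constructor
  · rintro ⟨h1, h2⟩ ⟨u, v⟩ (h | h)
    · have := h1 u
      simp only at h
      subst h
      simpa using this
    · exact h2 u v h
  · intro h
    exact ⟨fun v => by simpa using h (v, v) (Or.inl rfl), fun u v huv => h (u, v) (Or.inr huv)⟩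

theorem IsTangle.mem_or_mem (hτ : IsTangle G k τ) {A B : Finset V} (h : IsSep G A B)
    (hk : (A ∩ B).card < k) : (A, B) ∈ τ ∨ (B, A) ∈ τ := by
  have := hτ.2.1 A B h hk
  tauto

theorem IsTangle.mem_of_subset_union (hτ : IsTangle G k τ) {A B : Finset V}
    {p q : Finset V × Finset V} (hp : p ∈ τ) (hq : q ∈ τ) (h : IsSep G A B)
    (hk : (A ∩ B).card < k) (hB : p.2 ∩ q.2 ⊆ B) : (A, B) ∈ τ := by
  rcases hτ.mem_or_mem h hk with h1 | h1
  · exact h1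
  · refine absurd ?_ (hτ.2.2 _ hp _ hq _ h1)
    refine coversG_iff.2 fun e he => ?_
    have h1 := (hτ.1 p hp).1.item he
    have h2 := (hτ.1 q hq).1.item he
    have h3 := @hB e.1
    have h4 := @hB e.2
    simp only [Finset.mem_inter] at h3 h4
    tauto

theorem IsTangle.inf_mem (hτ : IsTangle G k τ) {p q : Finset V × Finset V} (hp : p ∈ τ)
    (hq : IsSep G q.1 q.2) (hk : ((p.1 ∩ q.1) ∩ (p.2 ∪ q.2)).card < k) :
    (p.1 ∩ q.1, p.2 ∪ q.2) ∈ τ :=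
  hτ.mem_of_subset_union hp hp ((hτ.1 p hp).1.inf hq) hk (by
    intro x hx; simp only [Finset.mem_inter, Finset.mem_union] at *; tauto)

theorem IsTangle.nonempty (hk : 1 ≤ k) (hτ : IsTangle G k τ) : τ.Nonempty := by
  have h : IsSep G (∅ : Finset V) Finset.univ := isSep_iff.2 (by simp)
  rcases hτ.mem_or_mem h (by simpa using Nat.lt_of_lt_of_le one_pos hk) with h | h <;> exact ⟨_, h⟩

/-- The small side of `p` contains every vertex and edge in `Y`. -/
def Contains (A : Finset V) (Y : Finset (V × V)) : Prop := ∀ q ∈ Y, q.1 ∈ A ∧ q.2 ∈ A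

/-- Among the elements of a tangle of minimum order whose small side contains `Y`, there is one
whose small side contains all the others. -/
theorem IsTangle.exists_greatest (hk : 1 ≤ k) (hτ : IsTangle G k τ) (Y : Finset (V × V)) (o : ℕ)
    (ho : ∀ p ∈ τ, Contains p.1 Y → o ≤ (p.1 ∩ p.2).card) :
    ∃ m ∈ τ, ∀ p ∈ τ, Contains p.1 Y → (p.1 ∩ p.2).card = o → p.1 ⊆ m.1 := by
  classical
  let P : Finset (Finset V × Finset V) :=
    Finset.univ.filter fun p => p ∈ τ ∧ Contains p.1 Y ∧ (p.1 ∩ p.2).card = o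
  by_cases hP : P.Nonempty
  · obtain ⟨m, hm, hmax⟩ := P.exists_max_image (fun p => p.1.card) hP
    simp only [P, Finset.mem_filter, Finset.mem_univ, true_and] at hm hmax
    obtain ⟨hm, hmY, hmo⟩ := hm
    refine ⟨m, hm, fun p hp hpY hpo => ?_⟩
    have hok : o < k := hmo ▸ (hτ.1 m hm).2
    have hmod := (hτ.1 m hm).1.card_sup_add_card_inf (hτ.1 p hp).1
    have hinf : o ≤ ((m.1 ∩ p.1) ∩ (m.2 ∪ p.2)).card := by
      by_contra hlt
      refine hlt (ho _ (hτ.inf_mem hm (hτ.1 p hp).1 (by omega)) fun q hq => ?_)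
      have := hmY q hq
      have := hpY q hq
      simp only [Finset.mem_inter]
      tauto
    have hsup : (m.1 ∪ p.1, m.2 ∩ p.2) ∈ τ :=
      hτ.mem_of_subset_union hm hp ((hτ.1 m hm).1.sup (hτ.1 p hp).1) (by omega) subset_rfl
    have hsupY : Contains (m.1 ∪ p.1) Y := fun q hq => by
      have := hmY q hq
      simp only [Finset.mem_union]
      tauto
    have h1 := ho _ hsup hsupY
    have h2 := hmax _ ⟨hsup, hsupY, by simp only at h1 ⊢; omega⟩
    have h3 := Finset.eq_of_subset_of_card_le Finset.subset_union_left h2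
    rw [h3]
    exact Finset.subset_union_right
  · obtain ⟨m, hm⟩ := hτ.nonempty hk
    refine ⟨m, hm, fun p hp hpY hpo => absurd ⟨p, ?_⟩ hP⟩
    simp only [P, Finset.mem_filter, Finset.mem_univ, true_and]
    exact ⟨hp, hpY, hpo⟩

/-- The size of the witness constructed by `IsTangle.exists_items`. -/
def itemBound : ℕ → ℕ
  | 0 => 0
  | n + 1 => 1 + (itemBound n + itemBound n + itemBound n)

theorem IsTangle.exists_items (hk : 1 ≤ k) (hτ : IsTangle G k τ) (n : ℕ) :
    ∀ (Y₁ Y₂ Y₃ : Finset (V × V)) (o₁ o₂ o₃ : ℕ),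
      (∀ p ∈ τ, Contains p.1 Y₁ → o₁ ≤ (p.1 ∩ p.2).card) →
      (∀ p ∈ τ, Contains p.1 Y₂ → o₂ ≤ (p.1 ∩ p.2).card) →
      (∀ p ∈ τ, Contains p.1 Y₃ → o₃ ≤ (p.1 ∩ p.2).card) → 3 * k ≤ o₁ + o₂ + o₃ + n →
      ∃ Q : Finset (V × V), Q.card ≤ itemBound n ∧ (∀ q ∈ Q, IsItem G q) ∧
        ∀ p₁ ∈ τ, ∀ p₂ ∈ τ, ∀ p₃ ∈ τ, Contains p₁.1 Y₁ → Contains p₂.1 Y₂ → Contains p₃.1 Y₃ →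
          ∃ q ∈ Q, ¬ (q.1 ∈ p₁.1 ∧ q.2 ∈ p₁.1) ∧ ¬ (q.1 ∈ p₂.1 ∧ q.2 ∈ p₂.1) ∧
            ¬ (q.1 ∈ p₃.1 ∧ q.2 ∈ p₃.1) := by
  induction n with
  | zero =>
    intro Y₁ Y₂ Y₃ o₁ o₂ o₃ h₁ h₂ h₃ hn
    refine ⟨∅, by simp, by simp, fun p₁ hp₁ p₂ hp₂ p₃ hp₃ c₁ c₂ c₃ => ?_⟩
    have := h₁ _ hp₁ c₁
    have := h₂ _ hp₂ c₂
    have := h₃ _ hp₃ c₃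
    have := (hτ.1 _ hp₁).2
    have := (hτ.1 _ hp₂).2
    have := (hτ.1 _ hp₃).2
    omega
  | succ n ih =>
    intro Y₁ Y₂ Y₃ o₁ o₂ o₃ h₁ h₂ h₃ hn
    obtain ⟨m₁, hm₁, g₁⟩ := hτ.exists_greatest hk Y₁ o₁ h₁
    obtain ⟨m₂, hm₂, g₂⟩ := hτ.exists_greatest hk Y₂ o₂ h₂
    obtain ⟨m₃, hm₃, g₃⟩ := hτ.exists_greatest hk Y₃ o₃ h₃
    have hnc := hτ.2.2 _ hm₁ _ hm₂ _ hm₃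
    rw [coversG_iff] at hnc
    push Not at hnc
    obtain ⟨q, hq, n₁, n₂, n₃⟩ := hnc
    have key : ∀ (Y : Finset (V × V)) (o : ℕ) (m : Finset V × Finset V),
        (∀ p ∈ τ, Contains p.1 Y → o ≤ (p.1 ∩ p.2).card) →
        (∀ p ∈ τ, Contains p.1 Y → (p.1 ∩ p.2).card = o → p.1 ⊆ m.1) →
        (q.1 ∈ m.1 → q.2 ∉ m.1) →
        ∀ p ∈ τ, Contains p.1 (insert q Y) → o + 1 ≤ (p.1 ∩ p.2).card := by
      intro Y o m h g hn p hp hc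
      have hY : Contains p.1 Y := fun x hx => hc x (Finset.mem_insert_of_mem hx)
      have hqp := hc q (Finset.mem_insert_self _ _)
      rcases (h p hp hY).lt_or_eq with h1 | h1
      · exact h1
      · have := g p hp hY h1.symm
        exact absurd (this hqp.2) (hn (this hqp.1))
    obtain ⟨Q₁, k₁, i₁, w₁⟩ := ih (insert q Y₁) Y₂ Y₃ (o₁ + 1) o₂ o₃
      (key _ _ _ h₁ g₁ n₁) h₂ h₃ (by omega)
    obtain ⟨Q₂, k₂, i₂, w₂⟩ := ih Y₁ (insert q Y₂) Y₃ o₁ (o₂ + 1) o₃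
      h₁ (key _ _ _ h₂ g₂ n₂) h₃ (by omega)
    obtain ⟨Q₃, k₃, i₃, w₃⟩ := ih Y₁ Y₂ (insert q Y₃) o₁ o₂ (o₃ + 1)
      h₁ h₂ (key _ _ _ h₃ g₃ n₃) (by omega)
    refine ⟨insert q (Q₁ ∪ Q₂ ∪ Q₃), ?_, ?_, ?_⟩
    · have e1 := Finset.card_insert_le q (Q₁ ∪ Q₂ ∪ Q₃)
      have e2 := Finset.card_union_le (Q₁ ∪ Q₂) Q₃
      have e3 := Finset.card_union_le Q₁ Q₂
      simp only [itemBound]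
      omega
    · intro x hx
      simp only [Finset.mem_insert, Finset.mem_union] at hx
      rcases hx with rfl | (hx | hx) | hx
      exacts [hq, i₁ x hx, i₂ x hx, i₃ x hx]
    · intro p₁ hp₁ p₂ hp₂ p₃ hp₃ c₁ c₂ c₃
      have ins : ∀ {Y : Finset (V × V)} {A : Finset V}, Contains A Y → (q.1 ∈ A ∧ q.2 ∈ A) →
          Contains A (insert q Y) := by
        intro Y A hc hqA x hx
        rcases Finset.mem_insert.1 hx with rfl | hx
        exacts [hqA, hc x hx]
      by_cases d₁ : q.1 ∈ p₁.1 ∧ q.2 ∈ p₁.1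
      · obtain ⟨x, hx, hw⟩ := w₁ p₁ hp₁ p₂ hp₂ p₃ hp₃ (ins c₁ d₁) c₂ c₃
        exact ⟨x, by simp [hx], hw⟩
      by_cases d₂ : q.1 ∈ p₂.1 ∧ q.2 ∈ p₂.1
      · obtain ⟨x, hx, hw⟩ := w₂ p₁ hp₁ p₂ hp₂ p₃ hp₃ c₁ (ins c₂ d₂) c₃
        exact ⟨x, by simp [hx], hw⟩
      by_cases d₃ : q.1 ∈ p₃.1 ∧ q.2 ∈ p₃.1
      · obtain ⟨x, hx, hw⟩ := w₃ p₁ hp₁ p₂ hp₂ p₃ hp₃ c₁ c₂ (ins c₃ d₃)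
        exact ⟨x, by simp [hx], hw⟩
      exact ⟨q, by simp, d₁, d₂, d₃⟩

/-- No three small sides of `τ` together contain all vertices and edges of `G[T]`. -/
def TripleCover (G : SimpleGraph V) (τ : Set (Finset V × Finset V)) (T : Finset V) : Prop :=
  ∀ p₁ ∈ τ, ∀ p₂ ∈ τ, ∀ p₃ ∈ τ, ∃ q, IsItem G q ∧ q.1 ∈ T ∧ q.2 ∈ T ∧
    ¬ (q.1 ∈ p₁.1 ∧ q.2 ∈ p₁.1) ∧ ¬ (q.1 ∈ p₂.1 ∧ q.2 ∈ p₂.1) ∧ ¬ (q.1 ∈ p₃.1 ∧ q.2 ∈ p₃.1)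

theorem IsTangle.exists_tripleCover (hk : 1 ≤ k) (hτ : IsTangle G k τ) :
    ∃ T : Finset V, T.card ≤ 2 * itemBound (3 * k) ∧ TripleCover G τ T := by
  obtain ⟨Q, hQ, hi, hw⟩ := hτ.exists_items hk (3 * k) ∅ ∅ ∅ 0 0 0 (by simp) (by simp) (by simp)
    (by simp)
  refine ⟨Q.image Prod.fst ∪ Q.image Prod.snd, ?_, fun p₁ h₁ p₂ h₂ p₃ h₃ => ?_⟩
  · have e1 := Finset.card_union_le (Q.image Prod.fst) (Q.image Prod.snd)
    have e2 := Finset.card_image_le (s := Q) (f := Prod.fst)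
    have e3 := Finset.card_image_le (s := Q) (f := Prod.snd)
    omega
  · obtain ⟨q, hq, hn⟩ := hw p₁ h₁ p₂ h₂ p₃ h₃ (by simp [Contains]) (by simp [Contains])
      (by simp [Contains])
    refine ⟨q, hi q hq, ?_, ?_, hn⟩
    · exact Finset.mem_union_left _ (Finset.mem_image_of_mem _ hq)
    · exact Finset.mem_union_right _ (Finset.mem_image_of_mem _ hq)

/-- A tangle with triple cover `T` transfers to any graph `G'` embedded in the vertices of `G`
that contains `G[T]` and whose low-order separations extend to `G` as far as `T` is concerned. -/
theorem IsTangle.transfer (hτ : IsTangle G k τ) {T : Finset V} (hT : TripleCover G τ T)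
    {V' : Type} [Fintype V'] [DecidableEq V'] {G' : SimpleGraph V'} {ι : V' → V}
    (hitem : ∀ q, IsItem G q → q.1 ∈ T → q.2 ∈ T →
      ∃ q', IsItem G' q' ∧ ι q'.1 = q.1 ∧ ι q'.2 = q.2)
    (hsep : ∀ A B, IsSep G' A B → (A ∩ B).card < k → ∃ C D, IsSep G C D ∧ (C ∩ D).card < k ∧
      (∀ x ∈ A, ι x ∈ T → ι x ∈ C) ∧ (∀ x ∈ B, ι x ∈ T → ι x ∈ D)) :
    ∃ τ', IsTangle G' k τ' ∧ TripleCover G' τ' (Finset.univ.filter fun x => ι x ∈ T) ∧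
      ∀ A B, IsSep G' A B → (A ∩ B).card < k →
        (∃ p ∈ τ, ∀ x, ι x ∈ p.2 → x ∈ B) → (A, B) ∈ τ' := by
  classical
  let τ' : Set (Finset V' × Finset V') := {p | IsSep G' p.1 p.2 ∧ (p.1 ∩ p.2).card < k ∧
    ∃ q ∈ τ, (∀ x ∈ p.1, ι x ∈ T → ι x ∈ q.1) ∧ (∀ x ∈ p.2, ι x ∈ T → ι x ∈ q.2)}
  have hcov : TripleCover G' τ' (Finset.univ.filter fun x => ι x ∈ T) := by
    rintro p₁ ⟨-, -, q₁, hq₁, h₁, -⟩ p₂ ⟨-, -, q₂, hq₂, h₂, -⟩ p₃ ⟨-, -, q₃, hq₃, h₃, -⟩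
    obtain ⟨q, hq, t₁, t₂, n₁, n₂, n₃⟩ := hT _ hq₁ _ hq₂ _ hq₃
    obtain ⟨q', hq', e₁, e₂⟩ := hitem q hq t₁ t₂
    rw [← e₁, ← e₂] at n₁ n₂ n₃
    rw [← e₁] at t₁
    rw [← e₂] at t₂
    refine ⟨q', hq', by simpa using t₁, by simpa using t₂, ?_, ?_, ?_⟩
    · exact fun h => n₁ ⟨h₁ _ h.1 t₁, h₁ _ h.2 t₂⟩
    · exact fun h => n₂ ⟨h₂ _ h.1 t₁, h₂ _ h.2 t₂⟩
    · exact fun h => n₃ ⟨h₃ _ h.1 t₁, h₃ _ h.2 t₂⟩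
  have hor : ∀ A B, IsSep G' A B → (A ∩ B).card < k → (A, B) ∈ τ' ∨ (B, A) ∈ τ' := by
    intro A B h hk
    obtain ⟨C, D, hCD, hlt, hA, hB⟩ := hsep A B h hk
    rcases hτ.mem_or_mem hCD hlt with h1 | h1
    · exact Or.inl ⟨h, hk, _, h1, hA, hB⟩
    · exact Or.inr ⟨h.symm, by rwa [Finset.inter_comm], _, h1, hB, hA⟩
  refine ⟨τ', ⟨fun p hp => ⟨hp.1, hp.2.1⟩, fun A B h hk => ⟨fun h1 h2 => ?_, fun h1 => ?_⟩, ?_⟩,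
    hcov, ?_⟩
  · obtain ⟨q, hq, -, -, n₁, n₂, -⟩ := hcov _ h1 _ h2 _ h2
    have := h.item hq
    tauto
  · exact (hor A B h hk).resolve_right h1
  · intro p₁ h₁ p₂ h₂ p₃ h₃ hc
    obtain ⟨q, hq, -, -, n⟩ := hcov _ h₁ _ h₂ _ h₃
    have := coversG_iff.1 hc q hq
    tauto
  · rintro A B h hk ⟨p, hp, hpB⟩
    refine (hor A B h hk).resolve_right ?_
    rintro ⟨-, -, q, hq, hq1, -⟩
    obtain ⟨x, hx, t₁, t₂, n₁, n₂, -⟩ := hT _ hp _ hq _ hq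
    obtain ⟨x', hx', e₁, e₂⟩ := hitem x hx t₁ t₂
    rcases (hτ.1 p hp).1.item hx with h1 | h1
    · exact n₁ h1
    · rw [← e₁] at h1 n₂ t₁
      rw [← e₂] at h1 n₂ t₂
      exact n₂ ⟨hq1 _ (hpB _ h1.1) t₁, hq1 _ (hpB _ h1.2) t₂⟩

end Tangles

section Menger

variable {H : SimpleGraph V} {k : ℕ} {X Y : Finset V}

/-- The graph `H` without the edges that are not inside `W`. -/
def inside (H : SimpleGraph V) (W : Finset V) : SimpleGraph V where
  Adj u v := H.Adj u v ∧ u ∈ W ∧ v ∈ W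
  symm := ⟨fun _ _ h => ⟨h.1.symm, h.2.2, h.2.1⟩⟩
  loopless := ⟨fun _ h => h.1.ne rfl⟩

theorem inside_le (H : SimpleGraph V) (W : Finset V) : inside H W ≤ H := fun _ _ h => h.1

theorem inside_mono {H' : SimpleGraph V} (hH : H ≤ H') {W W' : Finset V} (hW : W ⊆ W') :
    inside H W ≤ inside H' W' :=
  fun _ _ h => ⟨hH h.1, hW h.2.1, hW h.2.2⟩

/-- `W` spans a connected subgraph of `H` (or is empty). -/
def Linked (H : SimpleGraph V) (W : Finset V) : Prop :=
  ∀ x ∈ W, ∀ y ∈ W, (inside H W).Reachable x y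

theorem Linked.mono {H' : SimpleGraph V} (hH : H ≤ H') {W : Finset V} (h : Linked H W) :
    Linked H' W :=
  fun x hx y hy => (h x hx y hy).mono (inside_mono hH subset_rfl)

theorem reachable_invariant {K : SimpleGraph V} {P : V → Prop}
    (hP : ∀ u v, K.Adj u v → P u → P v) {x y : V} (h : K.Reachable x y) (hx : P x) : P y := by
  obtain ⟨p⟩ := h
  induction p with
  | nil => exact hx
  | cons hadj _ ih => exact ih (hP _ _ hadj hx)

theorem Linked.subset {A W : Finset V} (h : Linked (inside H A) W) {x : V} (hx : x ∈ W)
    (hxA : x ∈ A) : W ⊆ A := fun y hy =>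
  reachable_invariant (K := inside (inside H A) W) (P := fun v => v ∈ A)
    (fun _ _ huv _ => huv.1.2.2) (h x hx y hy) hxA

theorem Linked.union {W W' : Finset V} (h : Linked H W) (h' : Linked H W') {x y : V} (hx : x ∈ W)
    (hy : y ∈ W') (hxy : x = y ∨ H.Adj x y) : Linked H (W ∪ W') := by
  have e1 : inside H W ≤ inside H (W ∪ W') := inside_mono le_rfl Finset.subset_union_left
  have e2 : inside H W' ≤ inside H (W ∪ W') := inside_mono le_rfl Finset.subset_union_right
  have e3 : (inside H (W ∪ W')).Reachable x y := by
    rcases hxy with rfl | hxy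
    · rfl
    · exact SimpleGraph.Adj.reachable ⟨hxy, by simp [hx], by simp [hy]⟩
  have e4 : ∀ z ∈ W ∪ W', (inside H (W ∪ W')).Reachable z x := by
    intro z hz
    rcases Finset.mem_union.1 hz with hz | hz
    · exact (h z hz x hx).mono e1
    · exact ((h' z hz y hy).mono e2).trans e3.symm
  exact fun a ha b hb => (e4 a ha).trans (e4 b hb).symm

/-- `H` has no separation of order less than `k` with `X` on one and `Y` on the other side. -/
def Tight (H : SimpleGraph V) (k : ℕ) (X Y : Finset V) : Prop :=
  ∀ A B, IsSep H A B → X ⊆ A → Y ⊆ B → k ≤ (A ∩ B).card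

theorem Tight.symm (h : Tight H k X Y) : Tight H k Y X := fun A B hs hA hB => by
  rw [Finset.inter_comm]
  exact h B A hs.symm hB hA

theorem Tight.exists_cuts (h : Tight H k X Y) {u v : V} {A B : Finset V}
    (hs : IsSep (H.deleteEdges {s(u, v)}) A B) (hX : X ⊆ A) (hY : Y ⊆ B)
    (hk : (A ∩ B).card < k) : ∃ a b, s(a, b) = s(u, v) ∧ a ∈ A ∧ a ∉ B ∧ b ∉ A ∧ b ∈ B ∧
      IsSep H (insert b A) B ∧ IsSep H A (insert a B) ∧ (A ∩ B).card + 1 = k := by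
  have hsep : ¬ IsSep H A B := fun hs' => by
    have := h A B hs' hX hY
    omega
  rw [isSep_iff] at hsep
  push Not at hsep
  obtain ⟨a, b, hab, h1, h2⟩ := hsep hs.cover
  have heq : s(a, b) = s(u, v) := by
    by_contra hne
    have := hs.edge (u := a) (v := b) (by simpa [SimpleGraph.deleteEdges_adj, hab] using hne)
    tauto
  have hcase : ∃ a b, s(a, b) = s(u, v) ∧ a ∈ A ∧ a ∉ B ∧ b ∉ A ∧ b ∈ B := by
    have c2 := hs.cover b
    rcases hs.cover a with c1 | c1
    · have c3 := h1 c1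
      have c4 := c2.resolve_left c3
      exact ⟨a, b, heq, c1, fun c => h2 c c4, c3, c4⟩
    · have c3 := h2 c1
      have c4 := c2.resolve_right c3
      exact ⟨b, a, by rw [Sym2.eq_swap, heq], c4, c3, fun c => h1 c c4, c1⟩
  obtain ⟨a, b, heq, ha, ha', hb', hb⟩ := hcase
  have hedge : ∀ x y, H.Adj x y →
      (x ∈ A ∧ y ∈ A) ∨ (x ∈ B ∧ y ∈ B) ∨ (x = a ∧ y = b) ∨ (x = b ∧ y = a) := by
    intro x y hxy
    by_cases hne : s(x, y) = s(u, v)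
    · rw [← heq, Sym2.eq_iff] at hne
      exact Or.inr (Or.inr hne)
    · rcases hs.edge (u := x) (v := y)
        (by simpa [SimpleGraph.deleteEdges_adj, hxy] using hne) with h | h
      exacts [Or.inl h, Or.inr (Or.inl h)]
  have s1 : IsSep H (insert b A) B := by
    refine isSep_iff.2 ⟨fun x => ?_, fun x y hxy => ?_⟩
    · exact (hs.cover x).imp_left (Finset.mem_insert_of_mem)
    · rcases hedge x y hxy with h | h | ⟨rfl, rfl⟩ | ⟨rfl, rfl⟩ <;> simp [*]
  have s2 : IsSep H A (insert a B) := by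
    refine isSep_iff.2 ⟨fun x => ?_, fun x y hxy => ?_⟩
    · exact (hs.cover x).imp_right (Finset.mem_insert_of_mem)
    · rcases hedge x y hxy with h | h | ⟨rfl, rfl⟩ | ⟨rfl, rfl⟩ <;> simp [*]
  refine ⟨a, b, heq, ha, ha', hb', hb, s1, s2, ?_⟩
  have h3 := h _ _ s1 (hX.trans (Finset.subset_insert _ _)) hY
  rw [Finset.insert_inter_of_mem hb, Finset.card_insert_of_notMem (by simp [hb'])] at h3
  omega

/-- `W` is a family of `k` disjoint connected sets joining `X` to `Y`. -/
def IsLinkage (H : SimpleGraph V) (X Y : Finset V) (W : Fin k → Finset V) : Prop :=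
  (∀ i, Linked H (W i)) ∧ (∀ i j z, z ∈ W i → z ∈ W j → i = j) ∧
    (∀ i, ∃ x ∈ W i, x ∈ X) ∧ ∀ i, ∃ y ∈ W i, y ∈ Y

theorem IsLinkage.exists_contacts {W : Fin k → Finset V} (hW : IsLinkage H X Y W) {S : Finset V}
    (hS : S.card ≤ k) (hWS : ∀ i, ∃ x ∈ W i, x ∈ S) :
    ∃ σ : Fin k → V, (∀ i, σ i ∈ W i ∧ σ i ∈ S) ∧ Function.Injective σ ∧
      ∀ z ∈ S, ∃ i, σ i = z := by
  choose σ h1 h2 using hWS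
  have hinj : Function.Injective σ := fun i j hij => hW.2.1 i j (σ i) (h1 i) (hij ▸ h1 j)
  have himg : Finset.univ.image σ = S := by
    refine Finset.eq_of_subset_of_card_le ?_ ?_
    · intro z hz
      obtain ⟨i, -, rfl⟩ := Finset.mem_image.1 hz
      exact h2 i
    · rw [Finset.card_image_of_injective _ hinj]
      simpa using hS
  refine ⟨σ, fun i => ⟨h1 i, h2 i⟩, hinj, fun z hz => ?_⟩
  rw [← himg] at hz
  obtain ⟨i, -, hi⟩ := Finset.mem_image.1 hz
  exact ⟨i, hi⟩

/-- Two linkages on either side of a minimum separation combine across a critical edge. -/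
theorem IsLinkage.glue {A B : Finset V} {u v : V} (huv : H.Adj u v) (hk : (A ∩ B).card + 1 = k)
    (hu' : u ∉ B) (hv' : v ∉ A) {W₁ W₂ : Fin k → Finset V}
    (hX : X ⊆ A) (hY : Y ⊆ B) (h₁ : IsLinkage (inside H A) X (insert u (A ∩ B)) W₁)
    (h₂ : IsLinkage (inside H B) (insert v (A ∩ B)) Y W₂) :
    ∃ W : Fin k → Finset V, IsLinkage H X Y W := by
  classical
  have hWA : ∀ i, W₁ i ⊆ A := fun i => by
    obtain ⟨x, hx, hxX⟩ := h₁.2.2.1 i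
    exact (h₁.1 i).subset hx (hX hxX)
  have hWB : ∀ i, W₂ i ⊆ B := fun i => by
    obtain ⟨x, hx, hxY⟩ := h₂.2.2.2 i
    exact (h₂.1 i).subset hx (hY hxY)
  obtain ⟨σ, hσ, hσi, hσs⟩ := h₁.exists_contacts
    ((Finset.card_insert_le u (A ∩ B)).trans hk.le) h₁.2.2.2
  obtain ⟨ρ, hρ, hρi, hρs⟩ := h₂.exists_contacts
    ((Finset.card_insert_le v (A ∩ B)).trans hk.le) h₂.2.2.1
  have hmatch : ∀ i, ∃ j, (σ i = u ∧ ρ j = v) ∨ (σ i ≠ u ∧ ρ j = σ i) := by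
    intro i
    by_cases hi : σ i = u
    · obtain ⟨j, hj⟩ := hρs v (by simp)
      exact ⟨j, Or.inl ⟨hi, hj⟩⟩
    · obtain ⟨j, hj⟩ := hρs (σ i) (by
        have := (hσ i).2
        rw [Finset.mem_insert] at this ⊢
        tauto)
      exact ⟨j, Or.inr ⟨hi, hj⟩⟩
  choose π hπ using hmatch
  have hσv : ∀ i, σ i ≠ v := fun i hi => hv' (hi ▸ hWA i (hσ i).1)
  have hπi : Function.Injective π := by
    intro i j hij
    apply hσi
    have hi := hπ i
    have hj := hπ j
    rw [hij] at hi
    rcases hi with ⟨a, b⟩ | ⟨a, b⟩ <;> rcases hj with ⟨c, d⟩ | ⟨c, d⟩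
    · rw [a, c]
    · exact absurd (d.symm.trans b) (hσv j)
    · exact absurd (b.symm.trans d) (hσv i)
    · exact b.symm.trans d
  have hcross : ∀ i j z, z ∈ W₁ i → z ∈ W₂ (π j) → i = j := by
    intro i j z hz hz'
    have hzS : z ∈ A ∩ B := Finset.mem_inter.2 ⟨hWA i hz, hWB _ hz'⟩
    obtain ⟨i', hi'⟩ := hσs z (Finset.mem_insert_of_mem hzS)
    obtain rfl : i = i' := h₁.2.1 i i' z hz (hi' ▸ (hσ i').1)
    rcases hπ i with ⟨a, b⟩ | ⟨a, b⟩
    · exact absurd (Finset.mem_inter.1 hzS).2 (by rwa [← hi', a])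
    · apply hπi
      exact h₂.2.1 _ _ z (by rw [← hi', ← b]; exact (hρ _).1) hz'
  refine ⟨fun i => W₁ i ∪ W₂ (π i), fun i => ?_, fun i j z hi hj => ?_, fun i => ?_, fun i => ?_⟩
  · refine ((h₁.1 i).mono (inside_le _ _)).union ((h₂.1 (π i)).mono (inside_le _ _))
      (hσ i).1 (hρ (π i)).1 ?_
    rcases hπ i with ⟨a, b⟩ | ⟨a, b⟩
    · rw [a, b]
      exact Or.inr huv
    · exact Or.inl b.symm
  · rcases Finset.mem_union.1 hi with hi | hi <;> rcases Finset.mem_union.1 hj with hj | hj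
    · exact h₁.2.1 i j z hi hj
    · exact hcross i j z hi hj
    · exact (hcross j i z hj hi).symm
    · exact hπi (h₂.2.1 _ _ z hi hj)
  · obtain ⟨x, hx, hxX⟩ := h₁.2.2.1 i
    exact ⟨x, Finset.mem_union_left _ hx, hxX⟩
  · obtain ⟨x, hx, hxX⟩ := h₂.2.2.2 (π i)
    exact ⟨x, Finset.mem_union_right _ hx, hxX⟩

theorem IsLinkage.mono {H' : SimpleGraph V} (hH : H ≤ H') {W : Fin k → Finset V}
    (hW : IsLinkage H X Y W) : IsLinkage H' X Y W :=
  ⟨fun i => (hW.1 i).mono hH, hW.2⟩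

theorem Tight.inside_left (h : Tight H k X Y) {u : V} {A B : Finset V} (hX : X ⊆ A) (hY : Y ⊆ B)
    (hs : IsSep H A (insert u B)) : Tight (inside H A) k X (insert u (A ∩ B)) := by
  intro C D hCD hC hD
  have hsep : IsSep H (C ∩ A) (D ∪ insert u B) := by
    refine isSep_iff.2 ⟨fun x => ?_, fun x y hxy => ?_⟩
    · rw [Finset.mem_inter, Finset.mem_union]
      rcases hCD.cover x with h1 | h1 <;> rcases hs.cover x with h2 | h2 <;> tauto
    · simp only [Finset.mem_inter, Finset.mem_union]
      rcases hs.edge hxy with h2 | h2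
      · rcases hCD.edge (u := x) (v := y) ⟨hxy, h2⟩ with h1 | h1 <;> tauto
      · tauto
  refine (h _ _ hsep (Finset.subset_inter hC hX) ?_).trans (Finset.card_le_card ?_)
  · exact (hY.trans (Finset.subset_insert _ _)).trans Finset.subset_union_right
  · intro z hz
    have h1 := @hD z
    simp only [Finset.mem_inter, Finset.mem_union, Finset.mem_insert] at hz h1 ⊢
    tauto

/-- **Menger's theorem**, with connected sets in place of paths. -/
theorem Tight.exists_isLinkage (H : SimpleGraph V) (k : ℕ) : ∀ X Y : Finset V, Tight H k X Y →
    ∃ W : Fin k → Finset V, IsLinkage H X Y W := by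
  classical
  induction H using WellFoundedLT.induction with
  | ind H ih => 
  intro X Y h
  by_cases hc : ∃ u v A B, H.Adj u v ∧ IsSep (H.deleteEdges {s(u, v)}) A B ∧ X ⊆ A ∧ Y ⊆ B ∧
      (A ∩ B).card < k
  · obtain ⟨u, v, A, B, huv, hs, hX, hY, hk⟩ := hc
    obtain ⟨a, b, hab, ha, ha', hb', hb, s1, s2, hcard⟩ := h.exists_cuts hs hX hY hk
    have hadj : H.Adj a b := by rwa [← SimpleGraph.mem_edgeSet, hab]
    have l1 : inside H A < H := by
      refine lt_of_le_of_ne (inside_le _ _) fun he => hb' ?_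
      rw [← he] at hadj
      exact hadj.2.2
    have l2 : inside H B < H := by
      refine lt_of_le_of_ne (inside_le _ _) fun he => ha' ?_
      rw [← he] at hadj
      exact hadj.2.1
    obtain ⟨W₁, h₁⟩ := ih _ l1 _ _ (h.inside_left hX hY s2)
    have ht := (h.symm.inside_left hY hX s1.symm).symm
    rw [Finset.inter_comm] at ht
    obtain ⟨W₂, h₂⟩ := ih _ l2 _ _ ht
    exact IsLinkage.glue hadj hcard ha' hb' hX hY h₁ h₂
  · by_cases hbot : H = ⊥
    · have hsep : IsSep H X (Y ∪ Xᶜ) := by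
        subst hbot
        refine isSep_iff.2 ⟨fun x => ?_, fun x y hxy => hxy.elim⟩
        simp only [Finset.mem_union, Finset.mem_compl]
        tauto
      have := h _ _ hsep subset_rfl Finset.subset_union_left
      obtain ⟨S, hS, hcard⟩ := Finset.exists_subset_card_eq this
      let e := (S.equivFinOfCardEq hcard).symm
      have hmem : ∀ i, (e i : V) ∈ X ∧ (e i : V) ∈ Y := fun i => by
        have := hS (e i).2
        simp only [Finset.mem_union, Finset.mem_compl, Finset.mem_inter] at this
        tauto
      refine ⟨fun i => {(e i : V)}, fun i x hx y hy => ?_, fun i j z hi hj => ?_,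
        fun i => ⟨e i, by simp, (hmem i).1⟩, fun i => ⟨e i, by simp, (hmem i).2⟩⟩
      · rw [Finset.mem_singleton.1 hx, Finset.mem_singleton.1 hy]
      · apply e.injective
        apply Subtype.ext
        rw [← Finset.mem_singleton.1 hi, ← Finset.mem_singleton.1 hj]
    · obtain ⟨u, v, huv⟩ := SimpleGraph.ne_bot_iff_exists_adj.1 hbot
      have hlt : H.deleteEdges {s(u, v)} < H := by
        refine lt_of_le_of_ne (SimpleGraph.deleteEdges_le _) fun he => ?_
        rw [← he] at huv
        simp [SimpleGraph.deleteEdges_adj] at huv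
      obtain ⟨W, hW⟩ := ih _ hlt X Y fun A B hs hX hY => by
        by_contra hk
        exact hc ⟨u, v, A, B, huv, hs, hX, hY, by omega⟩
      exact ⟨W, hW.mono hlt.le⟩

end Menger

section Cuts

variable {H : SimpleGraph V} {k : ℕ} {X Y T : Finset V}

/-- A separation of order `k` with `X` on the left and `Y` on the right. -/
def IsCut (H : SimpleGraph V) (k : ℕ) (X Y : Finset V) (p : Finset V × Finset V) : Prop :=
  IsSep H p.1 p.2 ∧ X ⊆ p.1 ∧ Y ⊆ p.2 ∧ (p.1 ∩ p.2).card = k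

/-- The order in which larger pairs have larger left and smaller right side. -/
def SepLE (p q : Finset V × Finset V) : Prop := p.1 ⊆ q.1 ∧ q.2 ⊆ p.2

theorem SepLE.trans {p q r : Finset V × Finset V} (h : SepLE p q) (h' : SepLE q r) : SepLE p r :=
  ⟨h.1.trans h'.1, h'.2.trans h.2⟩

theorem IsCut.sup_inf (h : Tight H k X Y) {p q : Finset V × Finset V} (hp : IsCut H k X Y p)
    (hq : IsCut H k X Y q) :
    IsCut H k X Y (p.1 ∪ q.1, p.2 ∩ q.2) ∧ IsCut H k X Y (p.1 ∩ q.1, p.2 ∪ q.2) := by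
  have h1 := hp.1.sup hq.1
  have h2 := hp.1.inf hq.1
  have x1 := hp.2.1.trans (Finset.subset_union_left (s₂ := q.1))
  have x2 := Finset.subset_inter hp.2.1 hq.2.1
  have y1 := Finset.subset_inter hp.2.2.1 hq.2.2.1
  have y2 := hp.2.2.1.trans (Finset.subset_union_left (s₂ := q.2))
  have e := hp.1.card_sup_add_card_inf hq.1
  have e1 := h _ _ h1 x1 y1
  have e2 := h _ _ h2 x2 y2
  have e3 := hp.2.2.2
  have e4 := hq.2.2.2
  exact ⟨⟨h1, x1, y1, by simp only; omega⟩, ⟨h2, x2, y2, by simp only; omega⟩⟩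

theorem IsCut.exists_sup (h : Tight H k X Y) {v : V} (P : Finset (Finset V × Finset V)) :
    (∀ d ∈ P, IsCut H k X Y d ∧ v ∈ d.2) → ∀ c, IsCut H k X Y c → v ∈ c.1 → v ∈ c.2 →
      ∃ c', IsCut H k X Y c' ∧ v ∈ c'.1 ∧ v ∈ c'.2 ∧ ∀ d ∈ P, SepLE d c' := by
  classical
  induction P using Finset.induction_on with
  | empty => exact fun _ c hc h1 h2 => ⟨c, hc, h1, h2, by simp⟩
  | insert d P _ ih =>
    intro hP c hc h1 h2
    obtain ⟨c', hc', h1', h2', hle⟩ := ih (fun e he => hP e (Finset.mem_insert_of_mem he)) c hc h1 h2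
    obtain ⟨hd, hvd⟩ := hP d (Finset.mem_insert_self _ _)
    refine ⟨_, (hc'.sup_inf h hd).1, by simp [h1'], by simp [h2', hvd], fun e he => ?_⟩
    rcases Finset.mem_insert.1 he with rfl | he
    · exact ⟨Finset.subset_union_right, Finset.inter_subset_right⟩
    · exact (hle e he).trans ⟨Finset.subset_union_left, Finset.inter_subset_left⟩

theorem IsCut.exists_inf (h : Tight H k X Y) {v : V} (Q : Finset (Finset V × Finset V)) :
    (∀ d ∈ Q, IsCut H k X Y d ∧ v ∈ d.1) → ∀ c, IsCut H k X Y c → v ∈ c.1 → v ∈ c.2 →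
      ∃ c', IsCut H k X Y c' ∧ v ∈ c'.1 ∧ v ∈ c'.2 ∧ (∀ d ∈ Q, SepLE c' d) ∧
        ∀ r, SepLE r c → (∀ d ∈ Q, SepLE r d) → SepLE r c' := by
  classical
  induction Q using Finset.induction_on with
  | empty => exact fun _ c hc h1 h2 => ⟨c, hc, h1, h2, by simp, by simp⟩
  | insert d P _ ih =>
    intro hP c hc h1 h2
    obtain ⟨c', hc', h1', h2', hle, hr⟩ :=
      ih (fun e he => hP e (Finset.mem_insert_of_mem he)) c hc h1 h2
    obtain ⟨hd, hvd⟩ := hP d (Finset.mem_insert_self _ _)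
    refine ⟨_, (hc'.sup_inf h hd).2, by simp [h1', hvd], by simp [h2'], fun e he => ?_,
      fun r hrc hrd => ?_⟩
    · rcases Finset.mem_insert.1 he with rfl | he
      · exact ⟨Finset.inter_subset_right, Finset.subset_union_right⟩
      · exact SepLE.trans ⟨Finset.inter_subset_left, Finset.subset_union_left⟩ (hle e he)
    · have r1 := hr r hrc fun e he => hrd e (Finset.mem_insert_of_mem he)
      have r2 := hrd d (Finset.mem_insert_self _ _)
      exact ⟨Finset.subset_inter r1.1 r2.1, Finset.union_subset r1.2 r2.2⟩

/-- Some chain of minimum cuts meets every vertex lying on a minimum cut. -/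
theorem Tight.exists_chain (h : Tight H k X Y) : ∃ 𝒞 : Finset (Finset V × Finset V),
    (∀ p ∈ 𝒞, IsCut H k X Y p) ∧ (∀ p ∈ 𝒞, ∀ q ∈ 𝒞, SepLE p q ∨ SepLE q p) ∧
      ∀ c v, IsCut H k X Y c → v ∈ c.1 → v ∈ c.2 → ∃ d ∈ 𝒞, v ∈ d.1 ∧ v ∈ d.2 := by
  classical
  let good : Finset (Finset (Finset V × Finset V)) := Finset.univ.filter fun 𝒞 =>
    (∀ p ∈ 𝒞, IsCut H k X Y p) ∧ ∀ p ∈ 𝒞, ∀ q ∈ 𝒞, SepLE p q ∨ SepLE q p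
  have hne : good.Nonempty := ⟨∅, by simp [good]⟩
  obtain ⟨𝒞, h𝒞, hmax⟩ := good.exists_max_image Finset.card hne
  simp only [good, Finset.mem_filter, Finset.mem_univ, true_and] at h𝒞 hmax
  obtain ⟨hcut, hchain⟩ := h𝒞
  refine ⟨𝒞, hcut, hchain, fun c v hc h1 h2 => ?_⟩
  obtain ⟨c', hc', h1', h2', hsup⟩ := IsCut.exists_sup h (v := v) (𝒞.filter fun d => v ∉ d.1)
    (fun d hd => by
      rw [Finset.mem_filter] at hd
      exact ⟨hcut d hd.1, ((hcut d hd.1).1.cover v).resolve_left hd.2⟩) c hc h1 h2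
  obtain ⟨e, he, h1e, h2e, hinf, hgl⟩ := IsCut.exists_inf h (v := v) (𝒞.filter fun d => v ∈ d.1)
    (fun d hd => by
      rw [Finset.mem_filter] at hd
      exact ⟨hcut d hd.1, hd.2⟩) c' hc' h1' h2'
  have hcomp : ∀ d ∈ 𝒞, SepLE d e ∨ SepLE e d := by
    intro d hd
    by_cases hv : v ∈ d.1
    · exact Or.inr (hinf d (by simp [hd, hv]))
    · refine Or.inl (hgl d (hsup d (by simp [hd, hv])) fun q hq => ?_)
      rw [Finset.mem_filter] at hq
      exact (hchain d hd q hq.1).resolve_right fun hqd => hv (hqd.1 hq.2)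
  refine ⟨e, ?_, h1e, h2e⟩
  by_contra hnot
  have hins := hmax (insert e 𝒞) ⟨?_, ?_⟩
  · rw [Finset.card_insert_of_notMem hnot] at hins
    omega
  · intro p hp
    rcases Finset.mem_insert.1 hp with rfl | hp
    exacts [he, hcut p hp]
  · intro p hp q hq
    rcases Finset.mem_insert.1 hp with hp' | hp' <;> rcases Finset.mem_insert.1 hq with hq' | hq'
    · rw [hp', hq']
      exact Or.inl ⟨subset_rfl, subset_rfl⟩
    · exact hp' ▸ (hcomp q hq').symm
    · exact hq' ▸ hcomp p hp'
    · exact hchain p hp' q hq'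

/-- If many vertices lie on minimum cuts, then among the minimum cuts there are two comparable
ones with equal value of `f` and one of these vertices strictly in between. -/
theorem Tight.exists_between (h : Tight H k X Y) {ι : Type} [DecidableEq ι]
    (f : Finset V × Finset V → ι) (K : Finset ι) (hf : ∀ p, IsCut H k X Y p → f p ∈ K)
    (B : Finset V) (hB : ∀ v ∈ B, ∃ c, IsCut H k X Y c ∧ v ∈ c.1 ∧ v ∈ c.2)
    (hcard : K.card * (2 * k) < B.card) :
    ∃ p q, IsCut H k X Y p ∧ IsCut H k X Y q ∧ SepLE p q ∧ f p = f q ∧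
      ∃ v ∈ B, v ∉ p.1 ∧ v ∉ q.2 := by
  classical
  obtain ⟨𝒞, hcut, hchain, hon⟩ := h.exists_chain
  have hD : ∀ v : V, ∃ d, v ∈ B → d ∈ 𝒞 ∧ v ∈ d.1 ∧ v ∈ d.2 := by
    intro v
    by_cases hv : v ∈ B
    · obtain ⟨c, hc, h1, h2⟩ := hB v hv
      obtain ⟨d, hd⟩ := hon c v hc h1 h2
      exact ⟨d, fun _ => hd⟩
    · exact ⟨(∅, ∅), fun hv' => absurd hv' hv⟩
  choose D hD using hD
  obtain ⟨y, -, hy⟩ := Finset.exists_lt_card_fiber_of_mul_lt_card_of_maps_to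
    (s := B) (t := K) (f := fun v => f (D v)) (n := 2 * k)
    (fun v hv => hf _ (hcut _ (hD v hv).1)) hcard
  set U := B.filter fun v => f (D v) = y with hU
  have hUne : U.Nonempty := Finset.card_pos.1 (by omega)
  have hDU : ∀ v ∈ U, D v ∈ 𝒞 ∧ v ∈ (D v).1 ∧ v ∈ (D v).2 := fun v hv =>
    hD v (Finset.mem_filter.1 hv).1
  obtain ⟨a, ha, hmin⟩ := U.exists_min_image
    (fun v => (D v).1.card + (Fintype.card V - (D v).2.card)) hUne
  obtain ⟨b, hb, hmax⟩ := U.exists_max_image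
    (fun v => (D v).1.card + (Fintype.card V - (D v).2.card)) hUne
  have hle : ∀ v ∈ U, ∀ w ∈ U, (D v).1.card + (Fintype.card V - (D v).2.card) ≤
      (D w).1.card + (Fintype.card V - (D w).2.card) → SepLE (D v) (D w) := by
    intro v hv w hw hvw
    rcases hchain _ (hDU v hv).1 _ (hDU w hw).1 with h1 | h1
    · exact h1
    · have c1 := Finset.card_le_card h1.1
      have c2 := Finset.card_le_card h1.2
      have c3 := Finset.card_le_univ (D v).2
      have c4 := Finset.card_le_univ (D w).2
      have e1 := Finset.eq_of_subset_of_card_le h1.1 (by omega)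
      have e2 := Finset.eq_of_subset_of_card_le h1.2 (by omega)
      exact ⟨e1 ▸ subset_rfl, e2 ▸ subset_rfl⟩
  have hbd : (((D a).1 ∩ (D a).2) ∪ ((D b).1 ∩ (D b).2)).card < U.card := by
    refine (Finset.card_union_le _ _).trans_lt ?_
    have h1 := (hcut _ (hDU a ha).1).2.2.2
    have h2 := (hcut _ (hDU b hb).1).2.2.2
    omega
  obtain ⟨v, hvU, hv⟩ := Finset.exists_mem_notMem_of_card_lt_card hbd
  simp only [Finset.mem_union, Finset.mem_inter, not_or, not_and] at hv
  have hav := hle a ha v hvU (hmin v hvU)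
  have hvb := hle v hvU b hb (hmax v hvU)
  have hv' := hDU v hvU
  refine ⟨D a, D b, hcut _ (hDU a ha).1, hcut _ (hDU b hb).1, hav.trans hvb, ?_, v,
    (Finset.mem_filter.1 hvU).1, fun h1 => hv.1 h1 (hav.2 hv'.2.2), hv.2 (hvb.1 hv'.2.1)⟩
  rw [(Finset.mem_filter.1 ha).2, (Finset.mem_filter.1 hb).2]

end Cuts

section Reroute

theorem exists_mem_support_of_isSep {K : SimpleGraph V} {C D : Finset V}
    (hcov : ∀ x, x ∈ C ∨ x ∈ D) {a b : V} (p : K.Walk a b)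
    (he : ∀ u v, s(u, v) ∈ p.edges → (u ∈ C ∧ v ∈ C) ∨ (u ∈ D ∧ v ∈ D))
    (hC : a ∈ C ∨ b ∈ C) (hD : a ∈ D ∨ b ∈ D) : ∃ x ∈ p.support, x ∈ C ∧ x ∈ D := by
  induction p with
  | @nil a => exact ⟨a, by simp, by tauto, by tauto⟩
  | @cons a c b h p ih =>
    by_cases ha : a ∈ C ∧ a ∈ D
    · exact ⟨a, by simp, ha⟩
    · have hac := he a c (by simp)
      have := hcov a
      obtain ⟨x, hx, hx'⟩ := ih (fun u v huv => he u v (by simp [huv])) (by tauto) (by tauto)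
      exact ⟨x, by simp [hx], hx'⟩

theorem mem_of_mem_support_inside {K : SimpleGraph V} {Z : Finset V} {a b x : V} (ha : a ∈ Z)
    {p : (inside K Z).Walk a b} (hx : x ∈ p.support) : x ∈ Z :=
  reachable_invariant (K := inside K Z) (P := fun x => x ∈ Z) (fun _ _ huv _ => huv.2.2)
    (p.takeUntil x hx).reachable ha

/-- `v` has at most two neighbours in `K`. -/
def Thin (K : SimpleGraph V) (v : V) : Prop :=
  ∃ N : Finset V, N.card ≤ 2 ∧ ∀ w, K.Adj v w → w ∈ N

theorem SimpleGraph.Walk.IsPath.exists_neighbors {K : SimpleGraph V} {a b : V} {p : K.Walk a b}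
    (hp : p.IsPath) (v : V) : ∃ N : Finset V, N.card ≤ 2 ∧ (v = a → N.card ≤ 1) ∧
      ∀ w, s(v, w) ∈ p.edges → w ∈ N := by
  induction p with
  | nil => exact ⟨∅, by simp, by simp, by simp⟩
  | @cons a c b h p ih =>
    rw [SimpleGraph.Walk.cons_isPath_iff] at hp
    obtain ⟨N, hN, hN1, hNw⟩ := ih hp.1
    by_cases hva : v = a
    · subst hva
      refine ⟨{c}, by simp, by simp, fun w hw => ?_⟩
      rw [SimpleGraph.Walk.edges_cons, List.mem_cons] at hw
      rcases hw with hw | hw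
      · rw [Sym2.congr_right] at hw
        simp [hw]
      · exact absurd (p.fst_mem_support_of_mem_edges hw) hp.2
    · refine ⟨if v = c then insert a N else N, ?_, fun h => absurd h hva, fun w hw => ?_⟩
      · split_ifs with hvc
        · exact (Finset.card_insert_le _ _).trans (by have := hN1 hvc; omega)
        · exact hN
      · rw [SimpleGraph.Walk.edges_cons, List.mem_cons] at hw
        rcases hw with hw | hw
        · rw [Sym2.eq_iff] at hw
          rcases hw with hw | hw
          · exact absurd hw.1 hva
          · simp [hw.1, hw.2]
        · have := hNw w hw
          split_ifs
          · exact Finset.mem_insert_of_mem this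
          · exact this

variable {H : SimpleGraph V} {k : ℕ} {X Y T : Finset V} {W : Fin k → Finset V}
  {p q : Finset V × Finset V}

theorem IsLinkage.exists_contacts_of_isCut (hW : IsLinkage H X Y W) (hp : IsCut H k X Y p) :
    ∃ σ : Fin k → V, (∀ z ∈ p.1, z ∈ p.2 → ∃ i, σ i = z) ∧
      (∀ i, σ i ∈ W i ∧ σ i ∈ p.1 ∧ σ i ∈ p.2) ∧
      ∀ i, ∀ z ∈ W i, z ∈ p.1 → z ∈ p.2 → z = σ i := by
  have hmeet : ∀ i, ∃ x ∈ W i, x ∈ p.1 ∩ p.2 := by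
    intro i
    by_contra! hno
    obtain ⟨x, hxW, hxX⟩ := hW.2.2.1 i
    obtain ⟨y, hyW, hyY⟩ := hW.2.2.2 i
    have hy := reachable_invariant (P := fun v => v ∈ p.1) (fun u v huv hu => by
      rcases hp.1.edge huv.1 with h | h
      · exact h.2
      · exact absurd (Finset.mem_inter.2 ⟨hu, h.1⟩) (hno u huv.2.1)) (hW.1 i x hxW y hyW)
      (hp.2.1 hxX)
    exact hno y hyW (Finset.mem_inter.2 ⟨hy, hp.2.2.1 hyY⟩)
  obtain ⟨σ, h1, -, h3⟩ := hW.exists_contacts hp.2.2.2.le hmeet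
  refine ⟨σ, fun z hz1 hz2 => h3 z (Finset.mem_inter.2 ⟨hz1, hz2⟩), fun i => ⟨(h1 i).1, Finset.mem_inter.1 (h1 i).2⟩, fun i z hz hz1 hz2 => ?_⟩
  obtain ⟨j, hj⟩ := h3 z (Finset.mem_inter.2 ⟨hz1, hz2⟩)
  rw [hW.2.1 i j z hz (hj ▸ (h1 j).1), hj]

theorem Linked.reachable_between {Z : Finset V} (hZ : Linked H Z) (hp : IsSep H p.1 p.2)
    (hq : IsSep H q.1 q.2) (hpq : SepLE p q) {a b : V} (haZ : a ∈ Z) (ha1 : a ∈ p.1)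
    (ha : ∀ z ∈ Z, z ∈ p.1 → z ∈ p.2 → z = a) (hbZ : b ∈ Z) (hb2 : b ∈ q.2) (hb : ∀ z ∈ Z, z ∈ q.1 → z ∈ q.2 → z = b) :
    (inside H (Z ∩ (q.1 ∩ p.2))).Reachable a b := by
  by_contra hno
  have hab : a ≠ b := fun h => hno (h ▸ SimpleGraph.Reachable.refl _)
  have key := reachable_invariant (P := fun u => u ∈ p.1 ∨ (u ∈ q.1 ∧ u ∈ p.2 ∧
    (inside H (Z ∩ (q.1 ∩ p.2))).Reachable a u)) (K := inside H Z) (fun u v huv hu => ?_)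
    (hZ a haZ b hbZ) (Or.inl ha1)
  · rcases key with key | key
    · exact hab (ha b hbZ key (hpq.2 hb2)).symm
    · exact hno key.2.2
  · obtain ⟨hadj, huZ, hvZ⟩ := huv
    by_cases hv1 : v ∈ p.1
    · exact Or.inl hv1
    · have e1 := (hp.edge hadj).resolve_left fun h => hv1 h.2
      have hreach : u ∈ q.1 ∧ (inside H (Z ∩ (q.1 ∩ p.2))).Reachable a u := by
        rcases hu with hu | hu
        · rw [ha u huZ hu e1.1]
          exact ⟨hpq.1 ha1, SimpleGraph.Reachable.refl _⟩
        · exact ⟨hu.1, hu.2.2⟩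
      rcases hq.edge hadj with e2 | e2
      · refine Or.inr ⟨e2.2, e1.2, hreach.2.trans (SimpleGraph.Adj.reachable ⟨hadj, ?_, ?_⟩)⟩
        · simp [huZ, hreach.1, e1.1]
        · simp [hvZ, e2.2, e1.2]
      · exact absurd (hb u huZ hreach.1 e2.1 ▸ hreach.2) hno

/-- `(C, D)` is a separation of the subgraph of `H` induced by the left side of `p`. -/
def SplitsLeft (H : SimpleGraph V) (p : Finset V × Finset V) (C D : Finset V) : Prop :=
  C ∪ D = p.1 ∧ ∀ u v, H.Adj u v → u ∈ p.1 → v ∈ p.1 → (u ∈ C ∧ v ∈ C) ∨ (u ∈ D ∧ v ∈ D)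

/-- The indices of the linkage whose contact with the cut `p` lies in `C`. -/
def contactSet (W : Fin k → Finset V) (p : Finset V × Finset V) (C : Finset V) : Finset (Fin k) :=
  Finset.univ.filter fun i => ∃ x ∈ W i, x ∈ p.1 ∧ x ∈ p.2 ∧ x ∈ C

/-- The traces of the separation `(C, D)` of the left side of `p` that matter for gluing. -/
def cutTrace (W : Fin k → Finset V) (T : Finset V) (p : Finset V × Finset V) (C D : Finset V) :
    Finset V × Finset V × Finset (Fin k) × Finset (Fin k) × ℕ :=
  (C ∩ T, D ∩ T, contactSet W p C, contactSet W p D, ((C ∩ D) \ p.2).card)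

/-- The possible values of the trace of a separation of order less than `k`. -/
def traces (k : ℕ) (T : Finset V) :
    Finset (Finset V × Finset V × Finset (Fin k) × Finset (Fin k) × ℕ) :=
  T.powerset ×ˢ T.powerset ×ˢ Finset.univ ×ˢ Finset.univ ×ˢ Finset.range k

open Classical in
/-- The trace of `T` on the left side of the cut `p`, and the traces of all separations of that
side. -/
noncomputable def cutKey (H : SimpleGraph V) (W : Fin k → Finset V) (T : Finset V)
    (p : Finset V × Finset V) :
    Finset V × Finset (Finset V × Finset V × Finset (Fin k) × Finset (Fin k) × ℕ) :=
  (p.1 ∩ T, (traces k T).filter fun t => ∃ C D, SplitsLeft H p C D ∧ cutTrace W T p C D = t)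

/-- The possible values of `cutKey`. -/
def cutKeys (k : ℕ) (T : Finset V) :
    Finset (Finset V × Finset (Finset V × Finset V × Finset (Fin k) × Finset (Fin k) × ℕ)) :=
  T.powerset ×ˢ (traces k T).powerset

theorem cutKey_mem : cutKey H W T p ∈ cutKeys k T := by
  simp [cutKey, cutKeys, Finset.inter_subset_right, Finset.filter_subset]

/-- A bound for the number of possible cut keys. -/
def keyBound (k t : ℕ) : ℕ := 2 ^ t * 2 ^ (2 ^ t * (2 ^ t * (2 ^ k * (2 ^ k * k))))

theorem card_cutKeys : (cutKeys k T).card = keyBound k T.card := by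
  simp [cutKeys, traces, keyBound, Finset.card_product, Finset.card_powerset]

theorem keyBound_mono {t t' : ℕ} (h : t ≤ t') : keyBound k t ≤ keyBound k t' := by
  unfold keyBound
  gcongr <;> norm_num

theorem exists_splitsLeft_of_cutKey_eq (h : cutKey H W T p = cutKey H W T q) {C D : Finset V}
    (hs : SplitsLeft H p C D) (hk : ((C ∩ D) \ p.2).card < k) :
    ∃ C' D', SplitsLeft H q C' D' ∧ cutTrace W T q C' D' = cutTrace W T p C D := by
  classical
  have h1 : cutTrace W T p C D ∈ (cutKey H W T p).2 := by
    simp only [cutKey, Finset.mem_filter]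
    refine ⟨?_, C, D, hs, rfl⟩
    simp [cutTrace, traces, hk, Finset.inter_subset_right]
  rw [h] at h1
  simp only [cutKey, Finset.mem_filter] at h1
  exact h1.2

/-- The subgraph of `H` consisting of the edges on the left of `p`, the edges on the right of `q`
and the edges in `E`. -/
def reroute (H : SimpleGraph V) (p q : Finset V × Finset V) (E : Set (Sym2 V)) :
    SimpleGraph V where
  Adj u v := H.Adj u v ∧ ((u ∈ p.1 ∧ v ∈ p.1) ∨ (u ∈ q.2 ∧ v ∈ q.2) ∨ s(u, v) ∈ E)
  symm := ⟨fun u v h => ⟨h.1.symm, by rw [Sym2.eq_swap]; have := h.2; tauto⟩⟩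
  loopless := ⟨fun _ h => h.1.ne rfl⟩

/-- If `p ≤ q` are minimum cuts with the same key, then a linkage between their separators can
replace the part of `H` between them without creating new small separations of subsets of `T`. -/
theorem IsLinkage.tight_reroute (hW : IsLinkage H X Y W) (hp : IsCut H k X Y p)
    (hq : IsCut H k X Y q) (hpq : SepLE p q) (hkey : cutKey H W T p = cutKey H W T q)
    {E : Set (Sym2 V)} (hE : ∀ i, ∃ a b, ∃ P : H.Walk a b, a ∈ W i ∧ a ∈ p.1 ∧ a ∈ p.2 ∧
      b ∈ W i ∧ b ∈ q.1 ∧ b ∈ q.2 ∧ (∀ x ∈ P.support, x ∈ W i ∧ x ∈ q.1 ∧ x ∈ p.2) ∧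
      ∀ e ∈ P.edges, e ∈ E) {X' Y' : Finset V} (hX' : X' ⊆ T) (hY' : Y' ⊆ T)
    (h : Tight H k X' Y') : Tight (reroute H p q E) k X' Y' := by
  intro C D hCD hXC hYD
  by_contra! hlt
  obtain ⟨σ, -, hσ, hσu⟩ := hW.exists_contacts_of_isCut hp
  obtain ⟨ρ, hρs, hρ, hρu⟩ := hW.exists_contacts_of_isCut hq
  have hT : ∀ x ∈ T, x ∈ p.1 ↔ x ∈ q.1 := fun x hx => by
    have := congrArg (fun t => x ∈ t.1) hkey
    simpa [cutKey, hx] using this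
  have hsplit : SplitsLeft H p (C ∩ p.1) (D ∩ p.1) := by
    refine ⟨?_, fun u v huv hu hv => ?_⟩
    · ext x
      have := hCD.cover x
      simp only [Finset.mem_union, Finset.mem_inter]
      tauto
    · have := hCD.edge (u := u) (v := v) ⟨huv, Or.inl ⟨hu, hv⟩⟩
      simp only [Finset.mem_inter]
      tauto
  have hsmall : (((C ∩ p.1) ∩ (D ∩ p.1)) \ p.2).card < k := by
    refine (Finset.card_le_card fun x hx => ?_).trans_lt hlt
    simp only [Finset.mem_sdiff, Finset.mem_inter] at hx ⊢
    tauto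
  obtain ⟨C₂, D₂, ⟨hcov, hedge⟩, htr⟩ := exists_splitsLeft_of_cutKey_eq hkey hsplit hsmall
  simp only [cutTrace, Prod.mk.injEq] at htr
  obtain ⟨t1, t2, t3, t4, t5⟩ := htr
  have hcov' : ∀ x, x ∈ q.1 ↔ x ∈ C₂ ∨ x ∈ D₂ := fun x => by rw [← hcov, Finset.mem_union]
  have hsep : IsSep H (C₂ ∪ (C ∩ q.2)) (D₂ ∪ (D ∩ q.2)) := by
    refine isSep_iff.2 ⟨fun x => ?_, fun u v huv => ?_⟩
    · have h1 := hcov' x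
      have h2 := hq.1.cover x
      have h3 := hCD.cover x
      simp only [Finset.mem_union, Finset.mem_inter]
      tauto
    · simp only [Finset.mem_union, Finset.mem_inter]
      rcases hq.1.edge huv with h1 | h1
      · have := hedge u v huv h1.1 h1.2
        tauto
      · have := hCD.edge (u := u) (v := v) ⟨huv, Or.inr (Or.inl h1)⟩
        tauto
  have hsub : ∀ {Z Z₂ Z' : Finset V}, Z' ⊆ T → Z' ⊆ Z → Z₂ ∩ T = (Z ∩ p.1) ∩ T →
      Z' ⊆ Z₂ ∪ (Z ∩ q.2) := fun {Z Z₂ Z'} hZT hZ e x hx => by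
    have h1 := congrArg (fun t => x ∈ t) e
    have h2 := hT x (hZT hx)
    have h3 := hq.1.cover x
    have h4 := hZ hx
    have h5 := hZT hx
    simp only [Finset.mem_union, Finset.mem_inter, eq_iff_iff] at h1 ⊢
    tauto
  have hbig := h _ _ hsep (hsub hX' hXC t1) (hsub hY' hYD t2)
  have hcontact : ∀ {Z Z₂ : Finset V}, contactSet W q Z₂ = contactSet W p (Z ∩ p.1) → ∀ i,
      ρ i ∈ Z₂ → σ i ∈ Z := fun {Z Z₂} e i hi => by
    have h1 : i ∈ contactSet W q Z₂ := by
      simp only [contactSet, Finset.mem_filter, Finset.mem_univ, true_and]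
      exact ⟨ρ i, (hρ i).1, (hρ i).2.1, (hρ i).2.2, hi⟩
    rw [e] at h1
    simp only [contactSet, Finset.mem_filter, Finset.mem_univ, true_and, Finset.mem_inter] at h1
    obtain ⟨x, hx, hx1, hx2, hxZ⟩ := h1
    exact hσu i x hx hx1 hx2 ▸ hxZ.1
  -- the contacts of `q` in both sides of the new separation
  set I : Finset (Fin k) := Finset.univ.filter fun i =>
    ρ i ∈ C₂ ∪ (C ∩ q.2) ∧ ρ i ∈ D₂ ∪ (D ∩ q.2) with hI
  have hmid : ∀ i, ∃ z, i ∈ I → z ∈ W i ∧ z ∈ q.1 ∧ z ∈ p.2 ∧ z ∈ C ∧ z ∈ D := by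
    intro i
    by_cases hi : i ∈ I
    · obtain ⟨a, b, P, ha, ha1, ha2, hb, hb1, hb2, hsupp, hPE⟩ := hE i
      have ea := hσu i a ha ha1 ha2
      have eb := hρu i b hb hb1 hb2
      subst ea eb
      rw [hI, Finset.mem_filter] at hi
      obtain ⟨-, hi1, hi2⟩ := hi
      simp only [Finset.mem_union, Finset.mem_inter] at hi1 hi2
      obtain ⟨x, hx, hxC, hxD⟩ := exists_mem_support_of_isSep hCD.cover P
        (fun u v huv => hCD.edge ⟨P.adj_of_mem_edges huv, Or.inr (Or.inr (hPE _ huv))⟩)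
        (hi1.imp (hcontact t3 i) And.left) (hi2.imp (hcontact t4 i) And.left)
      have := hsupp x hx
      exact ⟨x, fun _ => ⟨this.1, this.2.1, this.2.2, hxC, hxD⟩⟩
    · exact ⟨ρ i, fun h => absurd h hi⟩
  choose z hz using hmid
  have hzinj : Set.InjOn z I := fun i hi j hj hij => by
    have h1 := (hz i hi).1
    rw [hij] at h1
    exact hW.2.1 i j _ h1 (hz j hj).1
  have c1 : (C₂ ∪ (C ∩ q.2)) ∩ (D₂ ∪ (D ∩ q.2)) ⊆
      ((C₂ ∩ D₂) \ q.2) ∪ ((C ∩ D) \ q.1) ∪ I.image ρ := by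
    intro x hx
    by_cases hx1 : x ∈ q.1
    · by_cases hx2 : x ∈ q.2
      · obtain ⟨i, rfl⟩ := hρs x hx1 hx2
        rw [Finset.mem_inter] at hx
        exact Finset.mem_union_right _ (Finset.mem_image_of_mem _ (by simpa [hI] using hx))
      · simp only [Finset.mem_union, Finset.mem_sdiff, Finset.mem_inter] at hx ⊢
        tauto
    · have := hcov' x
      simp only [Finset.mem_union, Finset.mem_sdiff, Finset.mem_inter] at hx ⊢
      tauto
  have c2 : (((C ∩ p.1) ∩ (D ∩ p.1)) \ p.2) ∪ ((C ∩ D) \ q.1) ∪ I.image z ⊆ C ∩ D := by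
    intro x hx
    simp only [Finset.mem_union, Finset.mem_sdiff, Finset.mem_inter, Finset.mem_image] at hx ⊢
    rcases hx with (hx | hx) | ⟨i, hi, rfl⟩
    · tauto
    · tauto
    · exact (hz i hi).2.2.2
  have d1 : Disjoint (((C ∩ p.1) ∩ (D ∩ p.1)) \ p.2) ((C ∩ D) \ q.1) := by
    rw [Finset.disjoint_left]
    intro x h1 h2
    simp only [Finset.mem_sdiff, Finset.mem_inter] at h1 h2
    exact h2.2 (hpq.1 h1.1.1.2)
  have d2 : Disjoint ((((C ∩ p.1) ∩ (D ∩ p.1)) \ p.2) ∪ ((C ∩ D) \ q.1)) (I.image z) := by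
    rw [Finset.disjoint_right]
    intro x h1 h2
    simp only [Finset.mem_union, Finset.mem_sdiff, Finset.mem_inter, Finset.mem_image] at h1 h2
    obtain ⟨i, hi, rfl⟩ := h1
    have := hz i hi
    tauto
  have e1 := Finset.card_le_card c1
  have e2 := Finset.card_le_card c2
  rw [Finset.card_union_of_disjoint d2, Finset.card_union_of_disjoint d1,
    Finset.card_image_of_injOn hzinj] at e2
  have e3 := Finset.card_union_le (((C₂ ∩ D₂) \ q.2) ∪ ((C ∩ D) \ q.1)) (I.image ρ)
  have e4 := Finset.card_union_le ((C₂ ∩ D₂) \ q.2) ((C ∩ D) \ q.1)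
  have e5 := Finset.card_image_le (s := I) (f := ρ)
  omega

theorem IsLinkage.exists_reroute (hW : IsLinkage H X Y W) (hp : IsCut H k X Y p)
    (hq : IsCut H k X Y q) (hpq : SepLE p q) (hkey : cutKey H W T p = cutKey H W T q) :
    ∃ K ≤ H, (∀ u ∈ T, ∀ v ∈ T, H.Adj u v → K.Adj u v) ∧
      (∀ X' ⊆ T, ∀ Y' ⊆ T, Tight H k X' Y' → Tight K k X' Y') ∧
      ∀ v, v ∉ p.1 → v ∉ q.2 → Thin K v := by
  obtain ⟨σ, -, hσ, hσu⟩ := hW.exists_contacts_of_isCut hp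
  obtain ⟨ρ, -, hρ, hρu⟩ := hW.exists_contacts_of_isCut hq
  have hpath : ∀ i, ∃ P : (inside H (W i ∩ (q.1 ∩ p.2))).Walk (σ i) (ρ i), P.IsPath := fun i =>
    ((hW.1 i).reachable_between hp.1 hq.1 hpq (hσ i).1 (hσ i).2.1 (hσu i) (hρ i).1 (hρ i).2.2
      (hρu i)).exists_isPath
  choose P hP using hpath
  have hedge : ∀ i u v, s(u, v) ∈ (P i).edges → u ∈ W i := fun i u v huv =>
    Finset.mem_of_mem_inter_left ((P i).adj_of_mem_edges huv).2.1
  have hT : ∀ x ∈ T, x ∈ p.1 ↔ x ∈ q.1 := fun x hx => by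
    have := congrArg (fun t => x ∈ t.1) hkey
    simpa [cutKey, hx] using this
  refine ⟨reroute H p q {e | ∃ i, e ∈ (P i).edges}, fun _ _ h => h.1, fun u hu v hv huv => ?_,
    fun X' hX' Y' hY' h => hW.tight_reroute hp hq hpq hkey (fun i => ?_) hX' hY' h,
    fun v hvp hvq => ?_⟩
  · refine ⟨huv, ?_⟩
    have := hq.1.edge huv
    have := hT u hu
    have := hT v hv
    tauto
  · refine ⟨σ i, ρ i, (P i).mapLe (inside_le _ _), (hσ i).1, (hσ i).2.1, (hσ i).2.2, (hρ i).1,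
      (hρ i).2.1, (hρ i).2.2, fun x hx => ?_, fun e he => ⟨i, by simpa using he⟩⟩
    have := mem_of_mem_support_inside (by simp [hσ i, hpq.1 (hσ i).2.1]) (p := P i)
      (by simpa using hx)
    simpa using this
  · by_cases hv : ∃ i w, s(v, w) ∈ (P i).edges
    · obtain ⟨i, w₀, hw₀⟩ := hv
      obtain ⟨N, hN, -, hNw⟩ := (hP i).exists_neighbors v
      refine ⟨N, hN, fun w hw => ?_⟩
      rcases hw.2 with h | h | ⟨j, hj⟩
      · exact absurd h.1 hvp
      · exact absurd h.1 hvq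
      · exact hNw w (hW.2.1 i j v (hedge i v _ hw₀) (hedge j v _ hj) ▸ hj)
    · refine ⟨∅, by simp, fun w hw => ?_⟩
      rcases hw.2 with h | h | ⟨j, hj⟩
      · exact absurd h.1 hvp
      · exact absurd h.1 hvq
      · exact absurd ⟨j, w, hj⟩ hv

end Reroute

section Sparse

variable {G : SimpleGraph V} {k : ℕ} {X Y T : Finset V}

theorem Tight.exists_isCut {H : SimpleGraph V} (h : Tight H k X Y) {v w : V}
    (hvw : ¬ Tight (H.deleteEdges {s(v, w)}) k X Y) : ∃ c, IsCut H k X Y c ∧ v ∈ c.1 ∧ v ∈ c.2 := by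
  unfold Tight at hvw
  push Not at hvw
  obtain ⟨A, B, hs, hX, hY, hlt⟩ := hvw
  obtain ⟨a, b, hab, ha, ha', hb, hb', hs1, hs2, hcard⟩ := h.exists_cuts hs hX hY hlt
  rcases Sym2.eq_iff.1 hab with ⟨rfl, -⟩ | ⟨-, rfl⟩
  · refine ⟨(A, insert a B), ⟨hs2, hX, hY.trans (Finset.subset_insert _ _), ?_⟩, ha, by simp⟩
    rw [Finset.inter_insert_of_mem ha, Finset.card_insert_of_notMem (by simp [ha']), hcard]
  · refine ⟨(insert b A, B), ⟨hs1, hX.trans (Finset.subset_insert _ _), hY, ?_⟩, by simp, hb'⟩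
    rw [Finset.insert_inter_of_mem hb', Finset.card_insert_of_notMem (by simp [hb]), hcard]

/-- `H` is a subgraph of `G` with the same edges on `T` and the same connectivity, up to `k`,
between subsets of `T`. -/
def Keeps (G : SimpleGraph V) (k : ℕ) (T : Finset V) (H : SimpleGraph V) : Prop :=
  H ≤ G ∧ (∀ u ∈ T, ∀ v ∈ T, G.Adj u v → H.Adj u v) ∧
    ∀ X ⊆ T, ∀ Y ⊆ T, Tight G k X Y → Tight H k X Y

/-- A bound for the number of vertices of a sparse graph that are not thin. -/
def branchBound (k t : ℕ) : ℕ := t + 2 ^ t * 2 ^ t * (keyBound k t * (2 * k))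

theorem branchBound_mono {t t' : ℕ} (h : t ≤ t') : branchBound k t ≤ branchBound k t' := by
  have := keyBound_mono (k := k) h
  unfold branchBound
  gcongr <;> norm_num

theorem exists_keeps_thin (G : SimpleGraph V) (k : ℕ) (T : Finset V) : ∃ H, Keeps G k T H ∧
    ∃ s : Finset V, T ⊆ s ∧ s.card ≤ branchBound k T.card ∧ ∀ v ∉ s, Thin H v := by
  classical
  obtain ⟨H, ⟨hHG, hHT, hHX⟩, hmin⟩ := WellFounded.has_min (wellFounded_lt (α := SimpleGraph V))
    {H | Keeps G k T H} ⟨G, le_rfl, fun _ _ _ _ h => h, fun _ _ _ _ h => h⟩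
  set Br : Finset V := Finset.univ.filter fun v => v ∉ T ∧ ¬ Thin H v with hBr
  refine ⟨H, ⟨hHG, hHT, hHX⟩, T ∪ Br, Finset.subset_union_left, ?_, fun v hv => ?_⟩
  swap
  · by_contra hthin
    simp only [hBr, Finset.mem_union, Finset.mem_filter, Finset.mem_univ, true_and] at hv
    tauto
  refine (Finset.card_union_le _ _).trans (Nat.add_le_add_left ?_ _)
  by_contra! hlt
  have hcut : ∀ v, ∃ XY : Finset V × Finset V, v ∈ Br → XY.1 ⊆ T ∧ XY.2 ⊆ T ∧
      Tight H k XY.1 XY.2 ∧ ∃ c, IsCut H k XY.1 XY.2 c ∧ v ∈ c.1 ∧ v ∈ c.2 := by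
    intro v
    by_cases hv : v ∈ Br
    swap
    · exact ⟨(∅, ∅), fun h => absurd h hv⟩
    rw [hBr, Finset.mem_filter] at hv
    obtain ⟨-, hvT, hv⟩ := hv
    obtain ⟨w, hw⟩ : ∃ w, H.Adj v w := by
      by_contra! hno
      exact hv ⟨∅, by simp, fun w hw => absurd hw (hno w)⟩
    have hlt : H.deleteEdges {s(v, w)} < H := by
      refine lt_of_le_of_ne (H.deleteEdges_le _) fun h => ?_
      rw [← h] at hw
      simp at hw
    have hnot := fun h => hmin (H.deleteEdges {s(v, w)}) h hlt
    by_contra! hno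
    refine hnot ⟨(H.deleteEdges_le _).trans hHG, fun a ha b hb hab => ?_, fun X hX Y hY h => ?_⟩
    · simp only [SimpleGraph.deleteEdges_adj, hHT a ha b hb hab, Set.mem_singleton_iff, true_and]
      intro h
      have : v ∈ s(a, b) := h ▸ Sym2.mem_mk_left _ _
      rcases Sym2.mem_iff.1 this with rfl | rfl
      · exact hvT ha
      · exact hvT hb
    · by_contra hn
      have ht := hHX X hX Y hY h
      obtain ⟨c, hc, h1, h2⟩ := ht.exists_isCut hn
      exact (hno (X, Y)).2 hX hY ht c hc h1 h2
  choose f hf using hcut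
  rw [← card_cutKeys] at hlt
  have hcard : (T.powerset ×ˢ T.powerset).card * ((cutKeys k T).card * (2 * k)) < Br.card := by
    simpa [Finset.card_product, Finset.card_powerset] using hlt
  obtain ⟨⟨X, Y⟩, -, hXY⟩ := Finset.exists_lt_card_fiber_of_mul_lt_card_of_maps_to
    (f := f) (fun v hv => by simp [hf v hv]) hcard
  set B := Br.filter fun v => f v = (X, Y) with hB
  have hfB : ∀ v ∈ B, X ⊆ T ∧ Y ⊆ T ∧ Tight H k X Y ∧ ∃ c, IsCut H k X Y c ∧ v ∈ c.1 ∧ v ∈ c.2 := by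
    intro v hv
    rw [hB, Finset.mem_filter] at hv
    have := hf v hv.1
    rwa [hv.2] at this
  obtain ⟨v₀, hv₀⟩ : B.Nonempty := Finset.card_pos.1 (by omega)
  obtain ⟨hX, hY, ht, -⟩ := hfB v₀ hv₀
  obtain ⟨W, hW⟩ := ht.exists_isLinkage
  obtain ⟨p, q, hp, hq, hpq, hkey, v, hv, hvp, hvq⟩ := ht.exists_between (cutKey H W T)
    (cutKeys k T) (fun _ _ => cutKey_mem) B (fun v hv => (hfB v hv).2.2.2) hXY
  obtain ⟨K, hKH, hKT, hKX, hthin⟩ := hW.exists_reroute hp hq hpq hkey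
  have hK : K = H := by
    by_contra hne
    exact hmin K ⟨hKH.trans hHG, fun a ha b hb hab => hKT a ha b hb (hHT a ha b hb hab),
      fun X hX Y hY h => hKX X hX Y hY (hHX X hX Y hY h)⟩ (lt_of_le_of_ne hKH hne)
  have h1 := hthin v hvp hvq
  rw [hK] at h1
  rw [hB, Finset.mem_filter, hBr, Finset.mem_filter] at hv
  exact hv.1.2.2 h1

end Sparse

section Reach

variable {H : SimpleGraph V} {s : Finset V}

theorem SimpleGraph.Walk.IsPath.exists_two_neighbors {K : SimpleGraph V} {a b : V} {p : K.Walk a b}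
    (hp : p.IsPath) {v : V} (hv : v ∈ p.support) (ha : v ≠ a) (hb : v ≠ b) :
    ∃ x ∈ p.support, ∃ y ∈ p.support, x ≠ y ∧ K.Adj v x ∧ K.Adj v y := by
  induction p with
  | nil => exact absurd (by simpa using hv) ha
  | @cons a c b h p ih =>
    rw [SimpleGraph.Walk.cons_isPath_iff] at hp
    have hvp : v ∈ p.support := by simpa [ha] using hv
    by_cases hvc : v = c
    · subst hvc
      cases p with
      | nil => exact absurd rfl hb
      | @cons _ d _ h' p =>
        refine ⟨a, by simp, d, by simp, ?_, h.symm, h'⟩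
        rintro rfl
        exact hp.2 (by simp)
    · obtain ⟨x, hx, y, hy, hxy⟩ := ih hp.1 hvp hvc hb
      exact ⟨x, by simp [hx], y, by simp [hy], hxy⟩

/-- The vertices of `s` adjacent to the component of `x` in `H - s`. -/
def Reaches (H : SimpleGraph V) (s : Finset V) (x u : V) : Prop :=
  x ∉ s ∧ u ∈ s ∧ ∃ y, (inside H sᶜ).Reachable x y ∧ H.Adj y u

theorem not_mem_of_reachable_inside {x y : V} (hx : x ∉ s)
    (h : (inside H sᶜ).Reachable x y) : y ∉ s :=
  reachable_invariant (K := inside H sᶜ) (P := fun x => x ∉ s)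
    (fun _ _ huv _ => Finset.mem_compl.1 huv.2.2) h hx

theorem Reaches.adj {x y u : V} (h : Reaches H s y u) (hx : x ∉ s) (hxy : H.Adj x y) :
    Reaches H s x u := by
  obtain ⟨hy, hu, z, hz, hzu⟩ := h
  exact ⟨hx, hu, z, (SimpleGraph.Adj.reachable (G := inside H sᶜ)
    ⟨hxy, by simp [hx], by simp [hy]⟩).trans hz, hzu⟩

theorem Reaches.of_reachable {x y u : V} (h : Reaches H s x u)
    (hxy : (inside H sᶜ).Reachable x y) : Reaches H s y u := by
  obtain ⟨hx, hu, z, hz, hzu⟩ := h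
  exact ⟨not_mem_of_reachable_inside hx hxy, hu, z, hxy.symm.trans hz, hzu⟩

theorem Reaches.exists_isPath {x u₁ u₂ : V} (h₁ : Reaches H s x u₁) (h₂ : Reaches H s x u₂)
    (hne : u₁ ≠ u₂) : ∃ Q : H.Walk u₁ u₂, Q.IsPath ∧
      (∀ z ∈ Q.support, z = u₁ ∨ z = u₂ ∨ (inside H sᶜ).Reachable x z) ∧
      ∃ z ∈ Q.support, (inside H sᶜ).Reachable x z := by
  obtain ⟨hx, hu₁, y₁, hy₁, hyu₁⟩ := h₁
  obtain ⟨-, hu₂, y₂, hy₂, hyu₂⟩ := h₂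
  obtain ⟨P, hP⟩ := (hy₁.symm.trans hy₂).exists_isPath
  have hPr : ∀ z ∈ P.support, (inside H sᶜ).Reachable x z := fun z hz =>
    hy₁.trans (P.takeUntil z hz).reachable
  have hPs : ∀ z ∈ P.support, z ∉ s := fun z hz => not_mem_of_reachable_inside hx (hPr z hz)
  refine ⟨SimpleGraph.Walk.cons hyu₁.symm ((P.mapLe (inside_le _ _)).concat hyu₂), ?_, ?_,
    y₁, by simp, hy₁⟩
  · simp only [SimpleGraph.Walk.cons_isPath_iff, SimpleGraph.Walk.concat_isPath_iff,
      SimpleGraph.Walk.support_concat]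
    refine ⟨⟨(SimpleGraph.Walk.isPath_mapLe (inside_le _ _)).2 hP, ?_⟩, ?_⟩
    · simpa using fun h => hPs _ h hu₂
    · simpa [hne] using fun h => hPs _ h hu₁
  · intro z hz
    have hz' : z = u₁ ∨ z ∈ P.support ∨ z = u₂ := by simpa using hz
    have := hPr z
    tauto

/-- A component of `H - s` with thin vertices only has at most two neighbours in `s`. -/
theorem Reaches.eq_or_eq (hthin : ∀ v ∉ s, Thin H v) {x u₁ u₂ u : V} (h₁ : Reaches H s x u₁)
    (h₂ : Reaches H s x u₂) (hne : u₁ ≠ u₂) (h : Reaches H s x u) : u = u₁ ∨ u = u₂ := by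
  obtain ⟨Q, hQ, hQs, z₀, hz₀, hxz₀⟩ := h₁.exists_isPath h₂ hne
  obtain ⟨hx, hu, y, hy, hyu⟩ := h
  have hclosed : ∀ z ∈ Q.support, z ∉ s → ∀ w, H.Adj z w → w ∈ Q.support := by
    intro z hz hzs w hzw
    obtain ⟨a, ha, b, hb, hab, hza, hzb⟩ := hQ.exists_two_neighbors hz
      (fun e => hzs (e ▸ h₁.2.1)) (fun e => hzs (e ▸ h₂.2.1))
    obtain ⟨N, hN, hNz⟩ := hthin z hzs
    by_contra hw
    have hsub : {a, b, w} ⊆ N := by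
      intro v hv
      simp only [Finset.mem_insert, Finset.mem_singleton] at hv
      rcases hv with rfl | rfl | rfl <;> exact hNz _ (by assumption)
    have h3 : ({a, b, w} : Finset V).card = 3 := Finset.card_eq_three.2
      ⟨a, b, w, hab, fun h => hw (h ▸ ha), fun h => hw (h ▸ hb), rfl⟩
    have := Finset.card_le_card hsub
    omega
  have hyQ := reachable_invariant (K := inside H sᶜ) (P := fun z => z ∈ Q.support)
    (fun a b hab ha => hclosed a ha (Finset.mem_compl.1 hab.2.1) b hab.1)
    (hxz₀.symm.trans hy) hz₀
  rcases hQs u (hclosed y hyQ (not_mem_of_reachable_inside hx hy) u hyu) with h | h | h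
  · exact Or.inl h
  · exact Or.inr h
  · exact absurd hu (not_mem_of_reachable_inside hx h)

end Reach

section Torso

variable {G H : SimpleGraph V} {s : Finset V} {k : ℕ}

/-- The graph on `s` in which the neighbourhood of each component of `H - s` is made complete. -/
def torso (H : SimpleGraph V) (s : Finset V) : SimpleGraph {x : V // x ∈ s} where
  Adj u v := u ≠ v ∧ (H.Adj u v ∨ ∃ x, Reaches H s x u ∧ Reaches H s x v)
  symm := ⟨fun _ _ h => ⟨h.1.symm, h.2.imp (fun h => h.symm) fun ⟨x, h⟩ => ⟨x, h.2, h.1⟩⟩⟩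
  loopless := ⟨fun _ h => h.1 rfl⟩

theorem IsTopMinorOn.mono (h : H ≤ G) {G' : SimpleGraph {x : V // x ∈ s}}
    (hG' : IsTopMinorOn H s G') : IsTopMinorOn G s G' := by
  obtain ⟨P, hP, hPs, hPd⟩ := hG'
  refine ⟨fun u v huv => (P u v huv).mapLe h,
    fun u v huv => (SimpleGraph.Walk.isPath_mapLe h).2 (hP u v huv), ?_, ?_⟩
  · simpa using hPs
  · simpa using hPd

theorem torso_exists_isPath {u v : {x : V // x ∈ s}} (h : (torso H s).Adj u v) :
    ∃ P : H.Walk u v, P.IsPath ∧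
      ∀ x ∈ P.support, x = u ∨ x = v ∨ (Reaches H s x u ∧ Reaches H s x v) := by
  obtain ⟨hne, h | ⟨x, hu, hv⟩⟩ := h
  · refine ⟨SimpleGraph.Walk.cons h SimpleGraph.Walk.nil, by simp [h.ne], fun x hx => ?_⟩
    have : x = u.val ∨ x = v.val := by simpa using hx
    tauto
  · obtain ⟨Q, hQ, hQs, -⟩ := hu.exists_isPath hv (fun e => hne (Subtype.ext e))
    exact ⟨Q, hQ, fun z hz => (hQs z hz).imp_right fun h => h.imp_right fun h =>
      ⟨hu.of_reachable h, hv.of_reachable h⟩⟩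

theorem isTopMinorOn_torso (hthin : ∀ v ∉ s, Thin H v) : IsTopMinorOn H s (torso H s) := by
  choose P hP hPs using fun (u v : {x : V // x ∈ s}) (h : (torso H s).Adj u v) =>
    torso_exists_isPath h
  refine ⟨P, hP, fun u v h x hx hxu hxv => ?_, fun u v h u' v' h' hne x hx hx' => ?_⟩
  · exact (((hPs u v h x hx).resolve_left hxu).resolve_left hxv).1.1
  · by_cases hxs : x ∈ s
    · have h1 := hPs u v h x hx
      have h2 := hPs u' v' h' x hx'
      have h3 : ∀ y, ¬ Reaches H s x y := fun y hy => hy.1 hxs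
      have := h3 u
      have := h3 u'
      tauto
    · have hx0 : ∀ y : {x : V // x ∈ s}, x ≠ y := fun y e => hxs (e ▸ y.2)
      have h1 := ((hPs u v h x hx).resolve_left (hx0 u)).resolve_left (hx0 v)
      have h2 := ((hPs u' v' h' x hx').resolve_left (hx0 u')).resolve_left (hx0 v')
      have hne1 : u.val ≠ v.val := fun e => h.1 (Subtype.ext e)
      have e1 := h1.1.eq_or_eq hthin h1.2 hne1 h2.1
      have e2 := h1.1.eq_or_eq hthin h1.2 hne1 h2.2
      have hne2 := h'.1
      simp only [← Subtype.ext_iff] at e1 e2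
      refine absurd (Sym2.eq_iff.2 ?_) hne
      rcases e1 with rfl | rfl <;> rcases e2 with rfl | rfl <;> simp_all

theorem torso_connected (hs : s.Nonempty) (hc : ∀ x ∈ s, ∀ y ∈ s, H.Reachable x y) :
    (torso H s).Connected := by
  have : Nonempty {x : V // x ∈ s} := hs.to_subtype
  refine (SimpleGraph.connected_iff _).2 ⟨fun u v => ?_, this⟩
  have key := reachable_invariant (P := fun x => (∀ h : x ∈ s, (torso H s).Reachable u ⟨x, h⟩) ∧
    ∀ (w : V) (h : w ∈ s), Reaches H s x w → (torso H s).Reachable u ⟨w, h⟩)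
    (fun x y hxy hx => ?_) (hc u u.2 v v.2)
    ⟨fun _ => SimpleGraph.Reachable.refl _, fun w _ hw => absurd u.2 hw.1⟩
  · exact key.1 v.2
  · by_cases hxs : x ∈ s
    · have hux := hx.1 hxs
      refine ⟨fun hys => hux.trans (SimpleGraph.Adj.reachable ⟨?_, Or.inl hxy⟩),
        fun w hws hw => ?_⟩
      · simpa using hxy.ne
      · by_cases hxw : x = w
        · subst hxw
          exact hux
        · exact hux.trans (SimpleGraph.Adj.reachable ⟨by simpa using hxw,
            Or.inr ⟨y, ⟨hw.1, hxs, y, SimpleGraph.Reachable.refl _, hxy.symm⟩, hw⟩⟩)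
    · refine ⟨fun hys => hx.2 y hys ⟨hxs, hys, x, SimpleGraph.Reachable.refl _, hxy⟩,
        fun w hws hw => hx.2 w hws (hw.adj hxs hxy)⟩

theorem torso_extend_isSep {A B : Finset {x : V // x ∈ s}} (h : IsSep (torso H s) A B) :
    ∃ C D, IsSep H C D ∧ (C ∩ D).card = (A ∩ B).card ∧ (∀ x ∈ A, x.val ∈ C) ∧
      ∀ x ∈ B, x.val ∈ D := by
  classical
  let Z : V → Prop := fun x => ∀ u : {x : V // x ∈ s}, Reaches H s x u → u ∈ A
  let C : Finset V := Finset.univ.filter fun x => (∀ h : x ∈ s, ⟨x, h⟩ ∈ A) ∧ (x ∉ s → Z x)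
  let D : Finset V := Finset.univ.filter fun x => (∀ h : x ∈ s, ⟨x, h⟩ ∈ B) ∧ (x ∉ s → ¬ Z x)
  have hC : ∀ x, x ∈ C ↔ (∀ h : x ∈ s, ⟨x, h⟩ ∈ A) ∧ (x ∉ s → Z x) := by simp [C]
  have hD : ∀ x, x ∈ D ↔ (∀ h : x ∈ s, ⟨x, h⟩ ∈ B) ∧ (x ∉ s → ¬ Z x) := by simp [D]
  have hCs : ∀ x : {x : V // x ∈ s}, x.val ∈ C ↔ x ∈ A := fun x => by simp [hC]
  have hDs : ∀ x : {x : V // x ∈ s}, x.val ∈ D ↔ x ∈ B := fun x => by simp [hD]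
  have hCn : ∀ x ∉ s, x ∈ C ↔ Z x := fun x hx => by simp [hC, hx]
  have hDn : ∀ x ∉ s, x ∈ D ↔ ¬ Z x := fun x hx => by simp [hD, hx]
  -- an edge leaving `s` stays on one side
  have hout : ∀ x ∉ s, ∀ y : {x : V // x ∈ s}, H.Adj x y →
      (x ∈ C ∧ y.val ∈ C) ∨ (x ∈ D ∧ y.val ∈ D) := by
    intro x hx y hxy
    have hr : Reaches H s x y := ⟨hx, y.2, x, SimpleGraph.Reachable.refl _, hxy⟩
    rw [hCn x hx, hDn x hx, hCs, hDs]
    by_cases hZ : Z x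
    · exact Or.inl ⟨hZ, hZ y hr⟩
    · refine Or.inr ⟨hZ, ?_⟩
      simp only [Z, not_forall] at hZ
      obtain ⟨u, hu, huA⟩ := hZ
      by_cases hyu : y = u
      · subst hyu
        exact (h.cover y).resolve_left huA
      · exact ((h.edge (u := y) (v := u) ⟨hyu, Or.inr ⟨x, hr, hu⟩⟩).resolve_left
          fun e => huA e.2).1
  refine ⟨C, D, isSep_iff.2 ⟨fun x => ?_, fun x y hxy => ?_⟩, ?_, fun x => (hCs x).2,
    fun x => (hDs x).2⟩
  · by_cases hx : x ∈ s
    · rw [hCs ⟨x, hx⟩, hDs ⟨x, hx⟩]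
      exact h.cover _
    · rw [hCn x hx, hDn x hx]
      exact em _
  · by_cases hx : x ∈ s <;> by_cases hy : y ∈ s
    · have := h.edge (u := ⟨x, hx⟩) (v := ⟨y, hy⟩) ⟨by simpa using hxy.ne, Or.inl hxy⟩
      simpa only [← hCs, ← hDs] using this
    · have := hout y hy ⟨x, hx⟩ hxy.symm
      tauto
    · exact hout x hx ⟨y, hy⟩ hxy
    · have : Z x ↔ Z y := ⟨fun hZ u hu => hZ u (hu.adj hx hxy), fun hZ u hu =>
        hZ u (hu.adj hy hxy.symm)⟩
      rw [hCn x hx, hDn x hx, hCn y hy, hDn y hy]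
      tauto
  · rw [← Finset.card_map (Function.Embedding.subtype _)]
    congr 1
    ext x
    simp only [Finset.mem_inter, Finset.mem_map, Function.Embedding.subtype_apply]
    constructor
    · rintro ⟨h1, h2⟩
      by_cases hx : x ∈ s
      · exact ⟨⟨x, hx⟩, ⟨(hCs _).1 h1, (hDs _).1 h2⟩, rfl⟩
      · exact absurd ((hCn x hx).1 h1) ((hDn x hx).1 h2)
    · rintro ⟨y, ⟨h1, h2⟩, rfl⟩
      exact ⟨(hCs y).2 h1, (hDs y).2 h2⟩

/-- A separation of `H` is approximated by one of the torso that leaves the trace of the right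
side on `s` unchanged. -/
theorem torso_restrict_isSep (hthin : ∀ v ∉ s, Thin H v) {A B : Finset V} (h : IsSep H A B) :
    ∃ A' B', IsSep (torso H s) A' B' ∧ (A' ∩ B').card ≤ (A ∩ B).card ∧
      (∀ x : {x : V // x ∈ s}, x.val ∈ A → x ∈ A') ∧
      ∀ x : {x : V // x ∈ s}, x ∈ B' ↔ x.val ∈ B := by
  classical
  let Q : {x : V // x ∈ s} → Prop := fun w => ∃ u : {x : V // x ∈ s}, u.val ∉ B ∧
    (torso H s).Adj u w
  let A' : Finset {x : V // x ∈ s} := Finset.univ.filter fun w => w.val ∈ A ∨ Q w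
  let B' : Finset {x : V // x ∈ s} := Finset.univ.filter fun w => w.val ∈ B
  have hA' : ∀ w, w ∈ A' ↔ w.val ∈ A ∨ Q w := by simp [A']
  have hB' : ∀ w, w ∈ B' ↔ w.val ∈ B := by simp [B']
  have hphi : ∀ w : {x : V // x ∈ s}, ∃ x, w ∈ A' ∩ B' → x ∈ A ∩ B ∧ (x = w.val ∨
      ∃ u : {x : V // x ∈ s}, u.val ∉ B ∧ Reaches H s x u ∧ Reaches H s x w) := by
    intro w
    by_cases hw : w ∈ A' ∩ B'
    swap
    · exact ⟨w, fun h => absurd h hw⟩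
    rw [Finset.mem_inter, hA', hB'] at hw
    by_cases hwA : w.val ∈ A
    · exact ⟨w, fun _ => ⟨Finset.mem_inter.2 ⟨hwA, hw.2⟩, Or.inl rfl⟩⟩
    obtain ⟨u, huB, huw⟩ := hw.1.resolve_left hwA
    obtain ⟨P, -, hP⟩ := torso_exists_isPath huw
    obtain ⟨x, hx, hxA, hxB⟩ := exists_mem_support_of_isSep h.cover P
      (fun a b hab => h.edge (P.adj_of_mem_edges hab)) (Or.inl ((h.cover u).resolve_right huB))
      (Or.inr hw.2)
    refine ⟨x, fun _ => ⟨Finset.mem_inter.2 ⟨hxA, hxB⟩, Or.inr ⟨u, huB, ?_⟩⟩⟩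
    rcases hP x hx with rfl | rfl | hr
    · exact absurd hxB huB
    · exact absurd hxA hwA
    · exact hr
  choose φ hφ using hphi
  refine ⟨A', B', isSep_iff.2 ⟨fun x => ?_, fun u v huv => ?_⟩, ?_, fun x hx => ?_, hB'⟩
  · rw [hA', hB']
    have := h.cover x.val
    tauto
  · simp only [hA', hB']
    by_cases hu : u.val ∈ B <;> by_cases hv : v.val ∈ B
    · exact Or.inr ⟨hu, hv⟩
    · exact Or.inl ⟨Or.inr ⟨v, hv, huv.symm⟩, Or.inl ((h.cover _).resolve_right hv)⟩
    · exact Or.inl ⟨Or.inl ((h.cover _).resolve_right hu), Or.inr ⟨u, hu, huv⟩⟩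
    · exact Or.inl ⟨Or.inl ((h.cover _).resolve_right hu), Or.inl ((h.cover _).resolve_right hv)⟩
  · refine Finset.card_le_card_of_injOn φ (fun w hw => (hφ w hw).1) fun w hw w' hw' e => ?_
    obtain ⟨-, h1⟩ := hφ w hw
    obtain ⟨-, h2⟩ := hφ w' hw'
    rw [Finset.mem_coe, Finset.mem_inter, hB'] at hw hw'
    rw [e] at h1
    rcases h1 with h1 | ⟨u, huB, hu, hw1⟩ <;> rcases h2 with h2 | ⟨u', huB', hu', hw2⟩
    · exact Subtype.ext (h1.symm.trans h2)
    · exact absurd w.2 (h1 ▸ hu'.1)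
    · exact absurd w'.2 (h2 ▸ hu.1)
    · rcases hu.eq_or_eq hthin hw1 (fun e => huB (e ▸ hw.2)) hw2 with e | e
      · exact absurd (e ▸ hw'.2) huB
      · exact Subtype.ext e.symm
  · exact (hA' x).2 (Or.inl hx)

end Torso

section Assembly

variable {G H : SimpleGraph V} {k : ℕ} {τ : Set (Finset V × Finset V)} {s T : Finset V}

theorem IsTangle.exists_subgraph (hτ : IsTangle G k τ) (hT : TripleCover G τ T) (hH : H ≤ G)
    (hHT : ∀ u ∈ T, ∀ v ∈ T, G.Adj u v → H.Adj u v)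
    (hsep : ∀ A B, IsSep H A B → (A ∩ B).card < k → ∃ C D, IsSep G C D ∧ (C ∩ D).card < k ∧
      A ∩ T ⊆ C ∧ B ∩ T ⊆ D) :
    ∃ τ', IsTangle H k τ' ∧ TripleCover H τ' T ∧ τ ⊆ τ' := by
  obtain ⟨τ', h1, h2, h3⟩ := hτ.transfer hT (G' := H) (ι := id)
    (fun q hq hq1 hq2 => ⟨q, hq.imp_right (hHT _ hq1 _ hq2), rfl, rfl⟩) (fun A B hAB hlt => by
      obtain ⟨C, D, hCD, hlt', hC, hD⟩ := hsep A B hAB hlt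
      exact ⟨C, D, hCD, hlt', fun x hx hxT => hC (Finset.mem_inter.2 ⟨hx, hxT⟩),
        fun x hx hxT => hD (Finset.mem_inter.2 ⟨hx, hxT⟩)⟩)
  refine ⟨τ', h1, by simpa using h2, fun p hp => ?_⟩
  have := hτ.1 p hp
  exact h3 p.1 p.2 (this.1.anti hH) this.2 ⟨p, hp, fun _ h => h⟩

theorem IsTangle.exists_sparse_subgraph (hτ : IsTangle G k τ) (hT : TripleCover G τ T) :
    ∃ H ≤ G, (∃ s : Finset V, T ⊆ s ∧ s.card ≤ branchBound k T.card ∧ ∀ v ∉ s, Thin H v) ∧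
      ∃ τ', IsTangle H k τ' ∧ TripleCover H τ' T ∧ τ ⊆ τ' := by
  obtain ⟨H, ⟨hHG, hHT, hHX⟩, hs⟩ := exists_keeps_thin G k T
  refine ⟨H, hHG, hs, hτ.exists_subgraph hT hHG hHT fun A B hAB hlt => ?_⟩
  have hnot : ¬ Tight G k (A ∩ T) (B ∩ T) := fun h =>
    (hHX _ Finset.inter_subset_right _ Finset.inter_subset_right h A B hAB
      Finset.inter_subset_left Finset.inter_subset_left).not_gt hlt
  unfold Tight at hnot
  push Not at hnot
  obtain ⟨C, D, h1, h2, h3, h4⟩ := hnot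
  exact ⟨C, D, h1, h4, h2, h3⟩

/-- A tangle lives in a component. -/
theorem IsTangle.exists_component (hk : 1 ≤ k) (hτ : IsTangle G k τ) : ∃ K : Finset V,
    (Kᶜ, K) ∈ τ ∧ (∀ x ∈ K, ∀ y, G.Adj x y → y ∈ K) ∧ ∀ x ∈ K, ∀ y ∈ K, G.Reachable x y := by
  classical
  have hclosed : ∀ K : Finset V, (Kᶜ, K) ∈ τ → ∀ x ∈ K, ∀ y, G.Adj x y → y ∈ K := by
    intro K hK x hx y hxy
    have := (hτ.1 _ hK).1.edge hxy
    simp only [Finset.mem_compl] at this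
    tauto
  have hsep : ∀ K : Finset V, (∀ x ∈ K, ∀ y, G.Adj x y → y ∈ K) →
      IsSep G Kᶜ K ∧ (Kᶜ ∩ K).card < k := by
    intro K hK
    refine ⟨isSep_iff.2 ⟨fun x => ?_, fun x y hxy => ?_⟩, by
      rw [Finset.inter_comm, Finset.inter_compl]
      exact hk⟩
    · rw [Finset.mem_compl]
      tauto
    · have h1 := hK x
      have h2 := hK y
      have h3 := fun hx => h1 hx y hxy
      have h4 := fun hy => h2 hy x hxy.symm
      simp only [Finset.mem_compl]
      tauto
  have hne : (Finset.univ.filter fun K : Finset V => (Kᶜ, K) ∈ τ).Nonempty := by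
    refine ⟨Finset.univ, ?_⟩
    have h1 := hsep Finset.univ (by simp)
    rcases hτ.mem_or_mem h1.1 h1.2 with h | h
    · simpa using h
    · exact absurd (coversG_iff.2 (by simp)) (hτ.2.2 _ h _ h _ h)
  obtain ⟨K, hK, hmin⟩ := Finset.exists_min_image _ Finset.card hne
  simp only [Finset.mem_filter, Finset.mem_univ, true_and] at hK hmin
  refine ⟨K, hK, hclosed K hK, fun x hx y hy => ?_⟩
  have hKc := hclosed K hK
  let R : Finset V := Finset.univ.filter fun z => G.Reachable x z
  have hR : ∀ z, z ∈ R ↔ G.Reachable x z := by simp [R]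
  have hRK : R ⊆ K := fun z hz => reachable_invariant (P := fun z => z ∈ K)
    (fun u v huv hu => hKc u hu v huv) ((hR z).1 hz) hx
  have hRc : ∀ u ∈ R, ∀ v, G.Adj u v → v ∈ R := fun u hu v huv =>
    (hR v).2 (((hR u).1 hu).trans huv.reachable)
  have h1 := hsep R hRc
  rcases hτ.mem_or_mem h1.1 h1.2 with h | h
  · exact (hR y).1 (Finset.eq_of_subset_of_card_le hRK (hmin R h) ▸ hy)
  · have h2 := hsep (K \ R) fun u hu v huv => by
      rw [Finset.mem_sdiff] at hu ⊢
      exact ⟨hKc u hu.1 v huv, fun hv => hu.2 (hRc v hv u huv.symm)⟩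
    have h3 := hmin _ (hτ.mem_of_subset_union hK h h2.1 h2.2 (by
      intro z hz
      simpa using hz))
    have h4 : (K \ R).card < K.card := Finset.card_lt_card
      (Finset.sdiff_ssubset hRK ⟨x, (hR x).2 (SimpleGraph.Reachable.refl _)⟩)
    omega

theorem IsTangle.exists_connected_subgraph (hk : 1 ≤ k) (hτ : IsTangle G k τ)
    (hT : TripleCover G τ T) (hTs : T ⊆ s) (hthin : ∀ v ∉ s, Thin G v) :
    ∃ H ≤ G, ∃ s' ⊆ s, ∃ T' ⊆ s', (∀ v ∉ s', Thin H v) ∧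
      (∀ x ∈ s', ∀ y ∈ s', H.Reachable x y) ∧
      ∃ τ', IsTangle H k τ' ∧ TripleCover H τ' T' ∧ τ ⊆ τ' := by
  classical
  obtain ⟨K, hK, hclosed, hreach⟩ := hτ.exists_component hk
  have hiff : ∀ {x y}, G.Adj x y → (x ∈ K ↔ y ∈ K) := fun h =>
    ⟨fun hx => hclosed _ hx _ h, fun hy => hclosed _ hy _ h.symm⟩
  have hiff' : ∀ q, IsItem G q → (q.1 ∈ K ↔ q.2 ∈ K) := by
    rintro q (h | h)
    · rw [h]
    · exact hiff h
  have hT' : TripleCover G τ (T ∩ K) := by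
    intro p₁ h₁ p₂ h₂ p₃ h₃
    have hmem : (p₁.1 ∪ Kᶜ, p₁.2 ∩ K) ∈ τ := by
      refine hτ.mem_of_subset_union h₁ hK ((hτ.1 _ h₁).1.sup (hτ.1 _ hK).1) ?_ subset_rfl
      refine (Finset.card_le_card fun x hx => ?_).trans_lt (hτ.1 _ h₁).2
      simp only [Finset.mem_inter, Finset.mem_union, Finset.mem_compl] at hx ⊢
      tauto
    obtain ⟨q, hq, hq1, hq2, n1, n2, n3⟩ := hT _ hmem _ h₂ _ h₃
    have := hiff' q hq
    simp only [Finset.mem_union, Finset.mem_compl] at n1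
    refine ⟨q, hq, ?_, ?_, ?_, n2, n3⟩
    · rw [Finset.mem_inter]
      tauto
    · rw [Finset.mem_inter]
      tauto
    · tauto
  obtain ⟨τ', h1, h2, h3⟩ := hτ.exists_subgraph hT' (inside_le G K) (fun u hu v hv huv =>
    ⟨huv, Finset.mem_of_mem_inter_right hu, Finset.mem_of_mem_inter_right hv⟩)
    (fun A B hAB hlt => by
      refine ⟨A ∪ Kᶜ, B ∩ K, isSep_iff.2 ⟨fun x => ?_, fun x y hxy => ?_⟩, ?_, ?_, ?_⟩
      · have := hAB.cover x
        simp only [Finset.mem_inter, Finset.mem_union, Finset.mem_compl]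
        tauto
      · have e := hiff hxy
        have := fun h : x ∈ K => hAB.edge (u := x) (v := y) ⟨hxy, h, e.1 h⟩
        simp only [Finset.mem_inter, Finset.mem_union, Finset.mem_compl]
        tauto
      · refine (Finset.card_le_card fun x hx => ?_).trans_lt hlt
        simp only [Finset.mem_inter, Finset.mem_union, Finset.mem_compl] at hx ⊢
        tauto
      · exact Finset.inter_subset_left.trans Finset.subset_union_left
      · exact Finset.inter_subset_inter_left Finset.inter_subset_right)
  refine ⟨inside G K, inside_le G K, s ∩ K, Finset.inter_subset_left, T ∩ K,
    Finset.inter_subset_inter_right hTs, fun v hv => ?_, fun x hx y hy => ?_, τ', h1, h2, h3⟩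
  · by_cases hvs : v ∈ s
    · refine ⟨∅, by simp, fun w hw => ?_⟩
      exact absurd (Finset.mem_inter.2 ⟨hvs, hw.2.1⟩) hv
    · obtain ⟨N, hN, hNv⟩ := hthin v hvs
      exact ⟨N, hN, fun w hw => hNv w hw.1⟩
  · rw [Finset.mem_inter] at hx hy
    exact (reachable_invariant (P := fun z => z ∈ K ∧ (inside G K).Reachable x z)
      (fun u v huv hu => ⟨hclosed u hu.1 v huv, hu.2.trans (SimpleGraph.Adj.reachable
        ⟨huv, hu.1, hclosed u hu.1 v huv⟩)⟩) (hreach x hx.2 y hy.2)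
      ⟨hx.2, SimpleGraph.Reachable.refl _⟩).2

theorem sum_extendByZero (w : {x : V // x ∈ s} → ℕ) (A : Finset V) :
    ∑ x ∈ A, extendByZero s w x = ∑ u with u.val ∈ A, w u := by
  classical
  rw [← Finset.sum_filter_add_sum_filter_not A (· ∈ s)]
  rw [Finset.sum_eq_zero (s := A.filter (· ∉ s)), add_zero]
  · refine (Finset.sum_bij (fun u _ => u.val) ?_ ?_ ?_ ?_).symm
    · simp
    · exact fun _ _ _ _ h => Subtype.ext h
    · intro x hx
      rw [Finset.mem_filter] at hx
      exact ⟨⟨x, hx.2⟩, by simp [hx.1], rfl⟩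
    · simp [extendByZero]
  · intro x hx
    rw [Finset.mem_filter] at hx
    simp [extendByZero, hx.2]

theorem IsTangle.exists_torso (hτ : IsTangle H k τ) (hT : TripleCover H τ T) (hTs : T ⊆ s)
    (hthin : ∀ v ∉ s, Thin H v) : ∃ τ', IsTangle (torso H s) k τ' ∧
      ∀ w, InducesW τ' w → InducesW τ (extendByZero s w) := by
  obtain ⟨τ', h1, -, h3⟩ := hτ.transfer hT (G' := torso H s) (ι := Subtype.val)
    (fun q hq hq1 hq2 => ⟨(⟨q.1, hTs hq1⟩, ⟨q.2, hTs hq2⟩), by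
      by_cases h : q.1 = q.2
      · exact Or.inl (Subtype.ext h)
      · exact Or.inr ⟨fun e => h (congrArg Subtype.val e), Or.inl (hq.resolve_left h)⟩, rfl, rfl⟩)
    (fun A B hAB hlt => by
      obtain ⟨C, D, hCD, hcard, hC, hD⟩ := torso_extend_isSep hAB
      exact ⟨C, D, hCD, hcard ▸ hlt, fun x hx _ => hC x hx, fun x hx _ => hD x hx⟩)
  refine ⟨τ', h1, fun w hw p hp => ?_⟩
  obtain ⟨hsep, hlt⟩ := hτ.1 p hp
  obtain ⟨A, B, hAB, hcard, hA, hB⟩ := torso_restrict_isSep hthin hsep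
  have := hw _ (h3 A B hAB (hcard.trans_lt hlt) ⟨p, hp, fun x hx => (hB x).2 hx⟩)
  rw [sum_extendByZero, sum_extendByZero]
  refine (Finset.sum_le_sum_of_subset (fun x hx => hA x (by simpa using hx))).trans_lt
    (this.trans_eq (Finset.sum_congr ?_ fun _ _ => rfl))
  ext x
  simp [hB]

theorem InducesSet.extend {τ' : Set (Finset {x : V // x ∈ s} × Finset {x : V // x ∈ s})}
    (h : ∀ w, InducesW τ' w → InducesW τ (extendByZero s w)) {X : Finset {x : V // x ∈ s}}
    (hX : InducesSet τ' X) : InducesSet τ (X.image Subtype.val) := by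
  intro p hp
  have := h (fun u => if u ∈ X then 1 else 0) (fun q hq => by
    simpa [Finset.sum_ite_mem, Finset.inter_comm] using hX q hq) p hp
  have key : ∀ A : Finset V, ((X.image Subtype.val) ∩ A).card =
      ∑ x ∈ A, extendByZero s (fun u => if u ∈ X then 1 else 0) x := by
    intro A
    rw [sum_extendByZero, Finset.sum_ite_mem, Finset.sum_const, smul_eq_mul, mul_one,
      ← Finset.card_image_of_injective _ Subtype.val_injective]
    congr 1
    ext x
    simp only [Finset.mem_inter, Finset.mem_image, Finset.mem_filter, Finset.mem_univ, true_and]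
    constructor
    · rintro ⟨⟨u, hu, rfl⟩, hA⟩
      exact ⟨u, ⟨hA, hu⟩, rfl⟩
    · rintro ⟨u, ⟨hA, hu⟩, rfl⟩
      exact ⟨⟨u, hu, rfl⟩, hA⟩
  rw [key, key]
  exact this

end Assembly

/-- For every `k ≥ 1` there is an `M` such that for every `k`-tangle `τ` in a graph `G` there
are a connected topological minor `G'` of `G` with fewer than `M` edges and a `k`-tangle `τ'`
in `G'` such that any weight function inducing `τ'` extends by zero to a weight function
inducing `τ`; in particular any vertex set inducing `τ'` also induces `τ`. -/
theorem stmt0 (k : ℕ) (hk : 1 ≤ k) :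
    ∃ M : ℕ, ∀ (V : Type) [Fintype V] [DecidableEq V] (G : SimpleGraph V)
      (τ : Set (Finset V × Finset V)), IsTangle G k τ →
      ∃ (s : Finset V) (G' : SimpleGraph {x : V // x ∈ s}),
        IsTopMinorOn G s G' ∧ G'.Connected ∧ G'.edgeSet.ncard < M ∧
        ∃ τ' : Set (Finset {x : V // x ∈ s} × Finset {x : V // x ∈ s}),
          IsTangle G' k τ' ∧
          (∀ w' : {x : V // x ∈ s} → ℕ,
            InducesW τ' w' → InducesW τ (extendByZero s w')) ∧
          ∀ X : Finset {x : V // x ∈ s},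
            InducesSet τ' X → InducesSet τ (X.image Subtype.val) := by
  let t := 2 * itemBound (3 * k)
  refine ⟨(branchBound k t).choose 2 + 1, fun V _ _ G τ hτ => ?_⟩
  obtain ⟨T, hTt, hT⟩ := hτ.exists_tripleCover hk
  obtain ⟨H, hHG, ⟨s, hTs, hst, hthin⟩, τ₁, hτ₁, hT₁, hle₁⟩ := hτ.exists_sparse_subgraph hT
  obtain ⟨K, hKH, s', hs's, T', hT's', hthin', hreach, τ₂, hτ₂, hT₂, hle₂⟩ :=
    hτ₁.exists_connected_subgraph hk hT₁ hTs hthin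
  obtain ⟨τ', hτ', hw⟩ := hτ₂.exists_torso hT₂ hT's' hthin'
  have hw' : ∀ w, InducesW τ' w → InducesW τ (extendByZero s' w) := fun w h p hp =>
    hw w h p (hle₂ (hle₁ hp))
  have hne : s'.Nonempty := by
    obtain ⟨p, hp⟩ := hτ₂.nonempty hk
    obtain ⟨q, -, hq, -⟩ := hT₂ p hp p hp p hp
    exact ⟨q.1, hT's' hq⟩
  refine ⟨s', torso K s', (isTopMinorOn_torso hthin').mono (hKH.trans hHG),
    torso_connected hne hreach, ?_, τ', hτ', hw', fun X hX => hX.extend hw'⟩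
  classical
  rw [← SimpleGraph.coe_edgeFinset, Set.ncard_coe_finset, Nat.lt_succ_iff]
  refine (SimpleGraph.card_edgeFinset_le_card_choose_two).trans (Nat.choose_le_choose 2 ?_)
  rw [Fintype.card_coe]
  exact (Finset.card_le_card hs's).trans (hst.trans (branchBound_mono hTt))
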